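/- For every integer n ≥ 2 and every Young diagram λ, the n-th free cumulant is expressed in terms of the parameters S_i^λ by R_n^λ = Σ_{l ≥ 1} (1/l!) · (−n+1)^{l−1} · Σ_{k_1,…,k_l ≥ 2, k_1+⋯+k_l = n} S_{k_1}^λ ⋯ S_{k_l}^λ. -/

import Mathlib

open scoped BigOperators

namespace AsympRep

/-- A fixed filling: the canonical bijection between `Fin μ.card` and the cells of `μ`. -/
noncomputable def fill (μ : YoungDiagram) : Fin μ.card ≃ {c // c ∈ μ.cells} :=
  (Fintype.equivFinOfCardEq (Fintype.card_coe _)).symm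

/-- Row coordinate of the box occupied by `x` in the canonical filling. -/
noncomputable def rowOf (μ : YoungDiagram) (x : Fin μ.card) : ℕ := (fill μ x).1.1

/-- Column coordinate of the box occupied by `x` in the canonical filling. -/
noncomputable def colOf (μ : YoungDiagram) (x : Fin μ.card) : ℕ := (fill μ x).1.2

/-- The Young symmetrizer `c_μ = a_μ * b_μ` in the group algebra `ℚ[S_n]`, `n = |μ|`,
where `a_μ` is the sum of the row-preserving permutations and `b_μ` is the signed sum
of the column-preserving permutations (for the canonical filling of `μ`). -/
noncomputable def youngSymmetrizer (μ : YoungDiagram) :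
    MonoidAlgebra ℚ (Equiv.Perm (Fin μ.card)) :=
  (∑ g : Equiv.Perm (Fin μ.card),
      if ∀ x, rowOf μ (g x) = rowOf μ x then MonoidAlgebra.single g (1 : ℚ) else 0) *
  (∑ g : Equiv.Perm (Fin μ.card),
      if ∀ x, colOf μ (g x) = colOf μ x
      then MonoidAlgebra.single g ((Equiv.Perm.sign g : ℤ) : ℚ) else 0)

/-- The Specht module: the left ideal `ℚ[S_n]·c_μ`, realizing the irreducible
representation `ρ^μ` of `S_n` (by left multiplication). -/
noncomputable def spechtModule (μ : YoungDiagram) :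
    Submodule ℚ (MonoidAlgebra ℚ (Equiv.Perm (Fin μ.card))) :=
  LinearMap.range (LinearMap.mulRight ℚ (youngSymmetrizer μ))

theorem spechtModule_invariant (μ : YoungDiagram) (π : Equiv.Perm (Fin μ.card)) :
    ∀ x ∈ spechtModule μ,
      (LinearMap.mulLeft ℚ (MonoidAlgebra.single π (1 : ℚ))) x ∈ spechtModule μ := by
  rintro x ⟨y, rfl⟩
  exact ⟨MonoidAlgebra.single π (1 : ℚ) * y, by
    simp only [LinearMap.mulRight_apply, LinearMap.mulLeft_apply, mul_assoc]⟩

/-- The irreducible character `χ^μ(π) = Tr ρ^μ(π)` of the symmetric group `S_n`,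
`n = |μ|`, computed as the trace of left multiplication by `π` on the Specht module. -/
noncomputable def irrChar (μ : YoungDiagram) (π : Equiv.Perm (Fin μ.card)) : ℚ :=
  LinearMap.trace ℚ (spechtModule μ)
    ((LinearMap.mulLeft ℚ (MonoidAlgebra.single π (1 : ℚ))).restrict
      (spechtModule_invariant μ π))

/-- The normalized character
`Σ_π^μ = n(n-1)⋯(n-k+1) · Tr ρ^μ(π) / Tr ρ^μ(e)` for `π ∈ S_k`, where `π` is regarded
as a permutation of `{1,…,n}` acting as the identity on `{k+1,…,n}`; it is `0` if `k > n`. -/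
noncomputable def normChar {k : ℕ} (μ : YoungDiagram) (π : Equiv.Perm (Fin k)) : ℚ :=
  if h : k ≤ μ.card then
    (μ.card.descFactorial k : ℚ)
      * irrChar μ (π.viaEmbedding (Fin.castLEEmb h)) / irrChar μ 1
  else 0

/-- `Σ_m^μ`: the normalized character on the `m`-cycle `(1,2,…,m) ∈ S_m`. -/
noncomputable def SigmaCycle (μ : YoungDiagram) (m : ℕ) : ℚ := normChar μ (finRotate m)

/-- The dilation `sμ` of a Young diagram: every box is replaced by an `s × s` grid
of boxes. -/
def dilate (μ : YoungDiagram) (s : ℕ) : YoungDiagram where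
  cells := (Finset.range (s * μ.colLen 0) ×ˢ Finset.range (s * μ.rowLen 0)).filter
      (fun c => (c.1 / s, c.2 / s) ∈ μ.cells)
  isLowerSet := by
    intro a b hba h
    simp only [Finset.coe_filter, Set.mem_setOf_eq, Finset.mem_product,
      Finset.mem_range] at h ⊢
    exact ⟨⟨lt_of_le_of_lt hba.1 h.1.1, lt_of_le_of_lt hba.2 h.1.2⟩,
      μ.isLowerSet (Prod.mk_le_mk.mpr
        ⟨Nat.div_le_div_right hba.1, Nat.div_le_div_right hba.2⟩) h.2⟩

open scoped Classical in
/-- The `k`-th free cumulant `R_k^μ`: the coefficient of `s^k` in the polynomial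
`s ↦ Σ_{k-1}^{sμ}`. -/
noncomputable def freeCumulant (μ : YoungDiagram) (k : ℕ) : ℚ :=
  if h : ∃ p : Polynomial ℚ, ∀ s : ℕ, 0 < s →
      SigmaCycle (dilate μ s) (k - 1) = Polynomial.eval (s : ℚ) p
  then h.choose.coeff k else 0

/-- `N^μ(σ₁,σ₂)`: the number of colorings of the cycles of `σ₁` (by column numbers)
and of the cycles of `σ₂` (by row numbers) compatible with `μ`.  A coloring of the
cycles is encoded as a pair of functions on points constant on the respective cycles;
compatibility means that for every point `a` the box in column `h₁(a)` and row `h₂(a)`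
belongs to `μ` (two cycles intersect precisely when they share a point). -/
noncomputable def Ncolorings {k : ℕ} (μ : YoungDiagram) (σ₁ σ₂ : Equiv.Perm (Fin k)) : ℕ :=
  Set.ncard {h : (Fin k → ℕ) × (Fin k → ℕ) |
    (∀ a, h.1 (σ₁ a) = h.1 a) ∧ (∀ a, h.2 (σ₂ a) = h.2 a) ∧
    ∀ a, (h.2 a, h.1 a) ∈ μ.cells }

/-- `|C(σ)|`: the number of cycles of a permutation (fixed points count as cycles),
i.e. the number of orbits. -/
noncomputable def numCycles {k : ℕ} (σ : Equiv.Perm (Fin k)) : ℕ :=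
  Set.ncard {s : Set (Fin k) | ∃ a, s = {b | σ.SameCycle a b}}

/-- The region of the plane occupied by the Young diagram `μ` drawn in the French
convention (row `i` of the diagram, `0`-indexed, occupies `[0, μ_i] × [i, i+1]`). -/
def frenchRegion (μ : YoungDiagram) : Set (ℝ × ℝ) :=
  {p | 0 ≤ p.1 ∧ 0 ≤ p.2 ∧ p.1 ≤ (μ.rowLen ⌊p.2⌋.toNat : ℝ)}

/-- The parameter `S_i^μ = (i-1) ∬_{(x,y)∈μ} (x-y)^{i-2} dx dy` (French convention). -/
noncomputable def Sparam (μ : YoungDiagram) (i : ℕ) : ℝ :=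
  ((i : ℝ) - 1) * ∫ p in frenchRegion μ, (p.1 - p.2) ^ (i - 2)

/-- The profile `ω : ℝ → ℝ` of a Young diagram: the boundary of the diagram drawn in
the Russian convention, i.e. the image of the French region under the rotation by `π/4`
composed with the dilation by `√2`, `(x, y) ↦ (x - y, x + y)`.  `ω(u)` is the largest
`v` with `(u,v)` in the rotated region, and `ω(u) = |u|` away from the diagram. -/
noncomputable def profile (μ : YoungDiagram) (u : ℝ) : ℝ :=
  max |u| (sSup {v : ℝ | ((u + v) / 2, (v - u) / 2) ∈ frenchRegion μ})

/-- A permutation of the canonical labels preserves the rows. -/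
def IsRowPerm (μ : YoungDiagram) (g : Equiv.Perm (Fin μ.card)) : Prop :=
  ∀ x, rowOf μ (g x) = rowOf μ x

/-- A permutation of the canonical labels preserves the columns. -/
def IsColPerm (μ : YoungDiagram) (g : Equiv.Perm (Fin μ.card)) : Prop :=
  ∀ x, colOf μ (g x) = colOf μ x

noncomputable instance (μ : YoungDiagram) : DecidablePred (IsRowPerm μ) := fun g =>
  inferInstanceAs (Decidable (∀ x, rowOf μ (g x) = rowOf μ x))

noncomputable instance (μ : YoungDiagram) : DecidablePred (IsColPerm μ) := fun g =>
  inferInstanceAs (Decidable (∀ x, colOf μ (g x) = colOf μ x))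

/-- The row symmetrizer. -/
noncomputable def rowSymmetrizer (μ : YoungDiagram) :
    MonoidAlgebra ℚ (Equiv.Perm (Fin μ.card)) :=
  ∑ g : Equiv.Perm (Fin μ.card), if IsRowPerm μ g then MonoidAlgebra.single g (1 : ℚ) else 0

/-- The column antisymmetrizer. -/
noncomputable def colAntisymmetrizer (μ : YoungDiagram) :
    MonoidAlgebra ℚ (Equiv.Perm (Fin μ.card)) :=
  ∑ g : Equiv.Perm (Fin μ.card),
    if IsColPerm μ g then MonoidAlgebra.single g ((Equiv.Perm.sign g : ℤ) : ℚ) else 0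

theorem youngSymmetrizer_eq (μ : YoungDiagram) :
    youngSymmetrizer μ = rowSymmetrizer μ * colAntisymmetrizer μ := rfl

theorem IsRowPerm.inv {μ : YoungDiagram} {g : Equiv.Perm (Fin μ.card)} (h : IsRowPerm μ g) :
    IsRowPerm μ g⁻¹ := fun x => by
  simpa using (h (g⁻¹ x)).symm

theorem IsColPerm.inv {μ : YoungDiagram} {g : Equiv.Perm (Fin μ.card)} (h : IsColPerm μ g) :
    IsColPerm μ g⁻¹ := fun x => by
  simpa using (h (g⁻¹ x)).symm

theorem IsRowPerm.mul {μ : YoungDiagram} {g h : Equiv.Perm (Fin μ.card)} (hg : IsRowPerm μ g)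
    (hh : IsRowPerm μ h) : IsRowPerm μ (g * h) := fun x => by
  rw [Equiv.Perm.mul_apply, hg, hh]

theorem IsColPerm.mul {μ : YoungDiagram} {g h : Equiv.Perm (Fin μ.card)} (hg : IsColPerm μ g)
    (hh : IsColPerm μ h) : IsColPerm μ (g * h) := fun x => by
  rw [Equiv.Perm.mul_apply, hg, hh]

theorem rowSymmetrizer_mul_single {μ : YoungDiagram} {p : Equiv.Perm (Fin μ.card)}
    (hp : IsRowPerm μ p) :
    rowSymmetrizer μ * MonoidAlgebra.single p 1 = rowSymmetrizer μ := by
  rw [rowSymmetrizer, Finset.sum_mul]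
  refine Fintype.sum_equiv (Equiv.mulRight p) _ _ fun g => ?_
  have : IsRowPerm μ (g * p) ↔ IsRowPerm μ g :=
    ⟨fun h => by simpa using h.mul hp.inv, fun h => h.mul hp⟩
  simp only [Equiv.coe_mulRight, this, ite_mul, zero_mul, MonoidAlgebra.single_mul_single, one_mul]

theorem single_mul_colAntisymmetrizer {μ : YoungDiagram} {q : Equiv.Perm (Fin μ.card)}
    (hq : IsColPerm μ q) :
    MonoidAlgebra.single q 1 * colAntisymmetrizer μ
      = ((Equiv.Perm.sign q : ℤ) : ℚ) • colAntisymmetrizer μ := by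
  rw [colAntisymmetrizer, Finset.mul_sum, Finset.smul_sum]
  refine Fintype.sum_equiv (Equiv.mulLeft q) _ _ fun g => ?_
  have : IsColPerm μ (q * g) ↔ IsColPerm μ g :=
    ⟨fun h => by simpa using hq.inv.mul h, fun h => hq.mul h⟩
  have h2 : (((Equiv.Perm.sign q : ℤ) : ℚ)) * ((Equiv.Perm.sign q : ℤ) : ℚ) = 1 := by
    exact_mod_cast Int.units_coe_mul_self _
  simp only [Equiv.coe_mulLeft, this, mul_ite, mul_zero, MonoidAlgebra.single_mul_single, one_mul,
    smul_ite, smul_zero, MonoidAlgebra.smul_single, smul_eq_mul, Equiv.Perm.sign_mul]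
  push_cast
  rw [← mul_assoc, h2, one_mul]

theorem sum_range_card_add_le_sum (s : Finset ℕ) :
    ∑ i ∈ Finset.range s.card, i + (Finset.range s.card \ s).card ≤ ∑ i ∈ s, i := by
  have h1 := Finset.sum_inter_add_sum_sdiff (Finset.range s.card) s (fun i => i)
  have h2 := Finset.sum_inter_add_sum_sdiff s (Finset.range s.card) (fun i => i)
  have hc : (s \ Finset.range s.card).card = (Finset.range s.card \ s).card := by
    have h3 := Finset.card_sdiff_add_card_inter (Finset.range s.card) s
    have h4 := Finset.card_sdiff_add_card_inter s (Finset.range s.card)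
    rw [Finset.inter_comm] at h4
    rw [Finset.card_range] at h3
    omega
  have h5 : (s \ Finset.range s.card).card * s.card ≤ ∑ i ∈ s \ Finset.range s.card, i := by
    rw [← smul_eq_mul]
    exact Finset.card_nsmul_le_sum _ _ _ fun i hi => by simpa using (Finset.mem_sdiff.1 hi).2
  have h6 : ∑ i ∈ Finset.range s.card \ s, (i + 1) ≤ (Finset.range s.card \ s).card * s.card := by
    rw [← smul_eq_mul]
    exact Finset.sum_le_card_nsmul _ _ _ fun i hi => by
      simpa [Nat.succ_le_iff] using (Finset.mem_sdiff.1 hi).1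
  rw [Finset.sum_add_distrib, Finset.sum_const, smul_eq_mul, mul_one] at h6
  rw [Finset.inter_comm] at h2
  rw [hc] at h5
  omega

theorem fill_fst (μ : YoungDiagram) (x : Fin μ.card) :
    (fill μ x : ℕ × ℕ) = (rowOf μ x, colOf μ x) := rfl

theorem exists_label {μ : YoungDiagram} {i j : ℕ} (h : (i, j) ∈ μ) :
    ∃ x, rowOf μ x = i ∧ colOf μ x = j :=
  ⟨(fill μ).symm ⟨(i, j), h⟩, by simp [rowOf], by simp [colOf]⟩

theorem label_mem (μ : YoungDiagram) (x : Fin μ.card) : (rowOf μ x, colOf μ x) ∈ μ :=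
  (fill μ x).2

theorem label_ext {μ : YoungDiagram} {x y : Fin μ.card} (h1 : rowOf μ x = rowOf μ y)
    (h2 : colOf μ x = colOf μ y) : x = y :=
  (fill μ).injective (Subtype.ext (Prod.ext h1 h2))

theorem image_row_filter_col (μ : YoungDiagram) (j : ℕ) :
    (Finset.univ.filter fun x => colOf μ x = j).image (rowOf μ) = Finset.range (μ.colLen j) := by
  ext i
  simp only [Finset.mem_image, Finset.mem_filter, Finset.mem_univ, true_and, Finset.mem_range,
    ← YoungDiagram.mem_iff_lt_colLen]
  constructor
  · rintro ⟨x, rfl, rfl⟩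
    exact label_mem μ x
  · intro h
    obtain ⟨x, h1, h2⟩ := exists_label h
    exact ⟨x, h2, h1⟩

/-- If no two entries of the same column are sent to the same row, then the column of `x` meets
the row of `g x`. -/
theorem row_col_mem {μ : YoungDiagram} {g : Equiv.Perm (Fin μ.card)}
    (hg : ∀ x y, rowOf μ (g x) = rowOf μ (g y) → colOf μ x = colOf μ y → x = y)
    (x : Fin μ.card) : (rowOf μ (g x), colOf μ x) ∈ μ := by
  set C : ℕ → Finset (Fin μ.card) := fun j => Finset.univ.filter fun x => colOf μ x = j with hC
  set s : ℕ → Finset ℕ := fun j => (C j).image fun x => rowOf μ (g x) with hs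
  set J := Finset.univ.image (colOf μ)
  have hinj : ∀ j, Set.InjOn (fun x => rowOf μ (g x)) (C j) := fun j a ha b hb hab =>
    hg a b hab (by
      simp only [hC, Finset.coe_filter, Finset.mem_univ, true_and] at ha hb
      exact ha.trans hb.symm)
  have hinj' : ∀ j, Set.InjOn (rowOf μ) (C j) := fun j a ha b hb hab =>
    label_ext hab (by
      simp only [hC, Finset.coe_filter, Finset.mem_univ, true_and] at ha hb
      exact ha.trans hb.symm)
  have hcard : ∀ j, (s j).card = μ.colLen j := fun j => by
    rw [Finset.card_image_of_injOn (hinj j), ← Finset.card_image_of_injOn (hinj' j),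
      image_row_filter_col, Finset.card_range]
  have hsum : ∀ f : Fin μ.card → ℕ, ∑ j ∈ J, ∑ x ∈ C j, f x = ∑ x, f x := fun f =>
    Finset.sum_fiberwise_of_maps_to (fun x _ => Finset.mem_image_of_mem _ (Finset.mem_univ x)) f
  have key : ∑ j ∈ J, (∑ i ∈ Finset.range (s j).card, i + (Finset.range (s j).card \ s j).card)
      ≤ ∑ j ∈ J, ∑ i ∈ Finset.range (s j).card, i := by
    calc _ ≤ ∑ j ∈ J, ∑ i ∈ s j, i := Finset.sum_le_sum fun j _ => sum_range_card_add_le_sum _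
      _ = ∑ j ∈ J, ∑ x ∈ C j, rowOf μ (g x) :=
        Finset.sum_congr rfl fun j _ => Finset.sum_image (hinj j)
      _ = ∑ x, rowOf μ (g x) := hsum _
      _ = ∑ x, rowOf μ x := Equiv.sum_comp g (rowOf μ)
      _ = ∑ j ∈ J, ∑ x ∈ C j, rowOf μ x := (hsum _).symm
      _ = _ := Finset.sum_congr rfl fun j _ => by
        rw [hcard, ← image_row_filter_col, Finset.sum_image (hinj' j)]
  rw [Finset.sum_add_distrib, add_le_iff_nonpos_right, nonpos_iff_eq_zero,
    Finset.sum_eq_zero_iff] at key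
  have hx := key (colOf μ x) (Finset.mem_image_of_mem _ (Finset.mem_univ x))
  rw [Finset.card_eq_zero, Finset.sdiff_eq_empty_iff_subset] at hx
  have h2 := Finset.eq_of_subset_of_card_le hx (by simp)
  rw [YoungDiagram.mem_iff_lt_colLen, ← hcard, ← Finset.mem_range, h2]
  exact Finset.mem_image_of_mem (fun x => rowOf μ (g x)) (by simp [hC])

theorem exists_rowPerm_mul_colPerm {μ : YoungDiagram} {g : Equiv.Perm (Fin μ.card)}
    (hg : ∀ x y, rowOf μ (g x) = rowOf μ (g y) → colOf μ x = colOf μ y → x = y) :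
    ∃ p q, IsRowPerm μ p ∧ IsColPerm μ q ∧ g = p * q := by
  choose q hq1 hq2 using fun x => exists_label (row_col_mem hg x)
  have hinj : Function.Injective q := fun x y h =>
    hg x y (by rw [← hq1, h, hq1]) (by rw [← hq2, h, hq2])
  let Q : Equiv.Perm (Fin μ.card) := Equiv.ofBijective q (Finite.injective_iff_bijective.1 hinj)
  refine ⟨g * Q⁻¹, Q, fun x => ?_, hq2, by simp⟩
  obtain ⟨y, rfl⟩ := Q.surjective x
  rw [Equiv.Perm.mul_apply, show Q⁻¹ (Q y) = y from Q.symm_apply_apply y]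
  exact (hq1 y).symm

theorem rowSymmetrizer_mul_single_mul_colAntisymmetrizer (μ : YoungDiagram)
    (g : Equiv.Perm (Fin μ.card)) :
    ∃ r : ℚ, rowSymmetrizer μ * MonoidAlgebra.single g 1 * colAntisymmetrizer μ
      = r • youngSymmetrizer μ := by
  by_cases hg : ∀ x y, rowOf μ (g x) = rowOf μ (g y) → colOf μ x = colOf μ y → x = y
  · obtain ⟨p, q, hp, hq, rfl⟩ := exists_rowPerm_mul_colPerm hg
    refine ⟨((Equiv.Perm.sign q : ℤ) : ℚ), ?_⟩
    rw [← one_mul (1 : ℚ), ← MonoidAlgebra.single_mul_single, ← mul_assoc,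
      rowSymmetrizer_mul_single hp, mul_assoc, single_mul_colAntisymmetrizer hq,
      mul_smul_comm, youngSymmetrizer_eq]
  · push Not at hg
    obtain ⟨x, y, h1, h2, hne⟩ := hg
    refine ⟨0, ?_⟩
    have hp : IsRowPerm μ (Equiv.swap (g x) (g y)) := fun z => by
      rw [Equiv.swap_apply_def]; split_ifs with h h <;> simp [h, h1]
    have hq : IsColPerm μ (Equiv.swap x y) := fun z => by
      rw [Equiv.swap_apply_def]; split_ifs with h h <;> simp [h, h2]
    have hgq : Equiv.swap (g x) (g y) * g = g * Equiv.swap x y := by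
      rw [Equiv.mul_swap_eq_swap_mul]
    have : rowSymmetrizer μ * MonoidAlgebra.single g 1 * colAntisymmetrizer μ
        = -(rowSymmetrizer μ * MonoidAlgebra.single g 1 * colAntisymmetrizer μ) := by
      conv_lhs => rw [← rowSymmetrizer_mul_single hp, mul_assoc (rowSymmetrizer μ),
        MonoidAlgebra.single_mul_single, hgq, ← MonoidAlgebra.single_mul_single, ← mul_assoc,
        mul_assoc _ (MonoidAlgebra.single (Equiv.swap x y) _), single_mul_colAntisymmetrizer hq]
      simp [Equiv.Perm.sign_swap hne]
    ext h
    have h3 := congrArg (fun v => v.coeff h) this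
    simp only [MonoidAlgebra.coeff_neg, Finsupp.neg_apply] at h3
    rw [self_eq_neg.1 h3, zero_smul, MonoidAlgebra.coeff_zero, Finsupp.zero_apply]

theorem exists_rowSymmetrizer_mul_mul_colAntisymmetrizer (μ : YoungDiagram)
    (x : MonoidAlgebra ℚ (Equiv.Perm (Fin μ.card))) :
    ∃ r : ℚ, rowSymmetrizer μ * x * colAntisymmetrizer μ = r • youngSymmetrizer μ := by
  induction x using MonoidAlgebra.induction_on with
  | of g => exact rowSymmetrizer_mul_single_mul_colAntisymmetrizer μ g
  | add x y hx hy =>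
    obtain ⟨r, hr⟩ := hx
    obtain ⟨t, ht⟩ := hy
    exact ⟨r + t, by rw [mul_add, add_mul, hr, ht, add_smul]⟩
  | smul r x hx =>
    obtain ⟨t, ht⟩ := hx
    exact ⟨r * t, by rw [mul_smul_comm, smul_mul_assoc, ht, mul_smul]⟩

theorem exists_youngSymmetrizer_mul_self (μ : YoungDiagram) :
    ∃ r : ℚ, youngSymmetrizer μ * youngSymmetrizer μ = r • youngSymmetrizer μ := by
  obtain ⟨r, hr⟩ := exists_rowSymmetrizer_mul_mul_colAntisymmetrizer μ
    (colAntisymmetrizer μ * rowSymmetrizer μ)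
  exact ⟨r, by rw [← hr, youngSymmetrizer_eq]; simp only [mul_assoc]⟩

theorem coeff_youngSymmetrizer (μ : YoungDiagram) (h : Equiv.Perm (Fin μ.card)) :
    (youngSymmetrizer μ).coeff h = ∑ q : Equiv.Perm (Fin μ.card),
      if IsColPerm μ q ∧ IsRowPerm μ (h * q⁻¹) then ((Equiv.Perm.sign q : ℤ) : ℚ) else 0 := by
  rw [youngSymmetrizer_eq, colAntisymmetrizer, Finset.mul_sum, MonoidAlgebra.coeff_sum,
    Finsupp.finsetSum_apply]
  refine Finset.sum_congr rfl fun q _ => ?_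
  by_cases hq : IsColPerm μ q
  · rw [if_pos hq, MonoidAlgebra.coeff_mul_single_apply, rowSymmetrizer, MonoidAlgebra.coeff_sum,
      Finsupp.finsetSum_apply, Finset.sum_eq_single (h * q⁻¹)]
    · by_cases hp : IsRowPerm μ (h * q⁻¹) <;> simp [hp, hq]
    · intro b _ hb
      split_ifs
      · simp [MonoidAlgebra.coeff_single, hb]
      · rfl
    · simp
  · simp [hq]

theorem coeff_youngSymmetrizer_one (μ : YoungDiagram) : (youngSymmetrizer μ).coeff 1 = 1 := by
  rw [coeff_youngSymmetrizer, Finset.sum_eq_single 1]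
  · rw [if_pos ⟨fun _ => rfl, fun _ => rfl⟩]; simp
  · intro q _ hq
    rw [if_neg]
    rintro ⟨h1, h2⟩
    rw [one_mul] at h2
    apply hq
    ext x
    have h3 := h2.inv x
    rw [inv_inv] at h3
    rw [label_ext h3 (h1 x), Equiv.Perm.one_apply]
  · simp

theorem trace_mulLeft_mulRight {G : Type*} [Group G] [Fintype G] [DecidableEq G] (π : G)
    (c : MonoidAlgebra ℚ G) :
    LinearMap.trace ℚ (MonoidAlgebra ℚ G)
      (LinearMap.mulLeft ℚ (MonoidAlgebra.single π (1 : ℚ)) ∘ₗ LinearMap.mulRight ℚ c)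
      = ∑ g : G, c.coeff (g⁻¹ * π⁻¹ * g) := by
  rw [LinearMap.trace_eq_matrix_trace ℚ (MonoidAlgebra.basis G ℚ), Matrix.trace]
  refine Finset.sum_congr rfl fun g _ => ?_
  rw [Matrix.diag_apply, LinearMap.toMatrix_apply]
  simp [MonoidAlgebra.basis, mul_assoc]

theorem mul_irrChar {μ : YoungDiagram} {r : ℚ}
    (hr : youngSymmetrizer μ * youngSymmetrizer μ = r • youngSymmetrizer μ)
    (π : Equiv.Perm (Fin μ.card)) :
    r * irrChar μ π
      = ∑ g : Equiv.Perm (Fin μ.card), (youngSymmetrizer μ).coeff (g⁻¹ * π⁻¹ * g) := by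
  rw [← trace_mulLeft_mulRight, irrChar]
  set T := LinearMap.mulRight ℚ (youngSymmetrizer μ) with hT
  set L := LinearMap.mulLeft ℚ (MonoidAlgebra.single π (1 : ℚ)) with hL
  set T' := T.codRestrict (spechtModule μ) (fun x => ⟨x, rfl⟩) with hT'
  have h1 : L ∘ₗ T
      = ((spechtModule μ).subtype ∘ₗ L.restrict (spechtModule_invariant μ π)) ∘ₗ T' := by
    ext x; rfl
  have h2 : T' ∘ₗ (spechtModule μ).subtype = r • LinearMap.id := by
    ext ⟨_, y, rfl⟩ : 2
    simp [hT', hT, mul_assoc, hr]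
  rw [h1, LinearMap.trace_comp_comm', ← LinearMap.comp_assoc, h2, LinearMap.smul_comp,
    LinearMap.id_comp, map_smul, smul_eq_mul]

theorem irrChar_div_irrChar_one (μ : YoungDiagram) (π : Equiv.Perm (Fin μ.card)) :
    irrChar μ π / irrChar μ 1 = (∑ g : Equiv.Perm (Fin μ.card),
      (youngSymmetrizer μ).coeff (g⁻¹ * π⁻¹ * g)) / (μ.card.factorial : ℚ) := by
  obtain ⟨r, hr⟩ := exists_youngSymmetrizer_mul_self μ
  have h1 : r * irrChar μ 1 = (μ.card.factorial : ℚ) := by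
    rw [mul_irrChar hr]
    simp [coeff_youngSymmetrizer_one, Fintype.card_perm]
  have h0 : (μ.card.factorial : ℚ) ≠ 0 := by exact_mod_cast Nat.factorial_ne_zero _
  rw [← mul_irrChar hr, ← h1, mul_div_mul_left]
  rintro rfl
  exact h0 (by rw [← h1, zero_mul])

section Compat

variable {X Y : Type*}

/-- A colouring `F` of points by boxes is compatible with `(σ₁, σ₂)` if columns are constant
along the cycles of `σ₁` and rows are constant along the cycles of `σ₂`. -/
def Compat (μ : YoungDiagram) (σ₁ σ₂ : Equiv.Perm X) (F : X → μ.cells) : Prop :=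
  (∀ a, (F (σ₁ a)).1.2 = (F a).1.2) ∧ ∀ a, (F (σ₂ a)).1.1 = (F a).1.1

noncomputable instance (μ : YoungDiagram) [Fintype X] (σ₁ σ₂ : Equiv.Perm X) (F : X → μ.cells) :
    Decidable (Compat μ σ₁ σ₂ F) :=
  inferInstanceAs (Decidable ((∀ a, (F (σ₁ a)).1.2 = (F a).1.2) ∧ ∀ a, (F (σ₂ a)).1.1 = (F a).1.1))

variable [Fintype X] [DecidableEq X]

/-- The signed number of factorizations `π = σ₁ σ₂` compatible with a colouring `F`. -/
noncomputable def signedCount (μ : YoungDiagram) (π : Equiv.Perm X) (F : X → μ.cells) : ℚ :=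
  ∑ σ : Equiv.Perm X, if Compat μ σ (σ⁻¹ * π) F then ((Equiv.Perm.sign σ : ℤ) : ℚ) else 0

theorem signedCount_eq_zero_of_not_injective {μ : YoungDiagram} (π : Equiv.Perm X)
    {F : X → μ.cells} (hF : ¬ Function.Injective F) : signedCount μ π F = 0 := by
  rw [Function.Injective] at hF
  push Not at hF
  obtain ⟨a, b, hab, hne⟩ := hF
  have hsw : ∀ x, F (Equiv.swap a b x) = F x := fun x => by
    rw [Equiv.swap_apply_def]; split_ifs with h h <;> simp [h, hab]
  have hiff : ∀ σ : Equiv.Perm X, Compat μ (σ * Equiv.swap a b) ((σ * Equiv.swap a b)⁻¹ * π) F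
      ↔ Compat μ σ (σ⁻¹ * π) F := fun σ => by
    simp only [Compat, mul_inv_rev, Equiv.swap_inv, mul_assoc, Equiv.Perm.mul_apply, hsw]
    refine and_congr_left fun _ => ⟨fun h x => ?_, fun h x => ?_⟩
    · have := h (Equiv.swap a b x)
      rwa [hsw, Equiv.swap_apply_self] at this
    · rw [h, hsw]
  have h : signedCount μ π F = - signedCount μ π F := by
    conv_lhs => rw [signedCount, ← Equiv.sum_comp (Equiv.mulRight (Equiv.swap a b))]
    rw [signedCount, ← Finset.sum_neg_distrib]
    refine Finset.sum_congr rfl fun σ _ => ?_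
    rw [Equiv.coe_mulRight, Equiv.Perm.sign_mul, Equiv.Perm.sign_swap hne, apply_ite Neg.neg,
      neg_zero]
    exact if_congr (hiff σ) (by simp) rfl
  exact self_eq_neg.1 h

theorem signedCount_viaEmbedding [Fintype Y] [DecidableEq Y] {μ : YoungDiagram}
    (e : X ↪ Y) (π : Equiv.Perm X) {F : Y → μ.cells} (hF : Function.Injective F) :
    signedCount μ (π.viaEmbedding e) F = signedCount μ π (F ∘ e) := by
  have hcases : ∀ (P : Y → Prop), (∀ y, P y) ↔ (∀ x, P (e x)) ∧ ∀ y, y ∉ Set.range e → P y :=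
    fun P => ⟨fun h => ⟨fun x => h _, fun y _ => h y⟩, fun h y => by
      by_cases hy : y ∈ Set.range e
      · obtain ⟨x, rfl⟩ := hy; exact h.1 x
      · exact h.2 y hy⟩
  have hmul : ∀ σ : Equiv.Perm X, (σ.viaEmbedding e)⁻¹ * π.viaEmbedding e
      = (σ⁻¹ * π).viaEmbedding e := fun σ => by
    simp only [← Equiv.Perm.viaEmbeddingHom_apply, map_mul, map_inv]
  rw [signedCount, signedCount]
  symm
  refine Finset.sum_of_injOn (fun σ => σ.viaEmbedding e)
    ((Equiv.Perm.viaEmbeddingHom_injective e).injOn) (by simp) ?_ ?_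
  · intro σ _ hσ
    rw [if_neg]
    rintro ⟨h1, h2⟩
    apply hσ
    have hfix : ∀ y, y ∉ Set.range e → σ⁻¹ y = y := fun y hy => by
      have h3 := h2 y
      rw [Equiv.Perm.mul_apply, Equiv.Perm.viaEmbedding_apply_of_notMem _ _ _ hy] at h3
      have h4 := h1 (σ⁻¹ y)
      rw [show σ (σ⁻¹ y) = y from σ.apply_symm_apply y] at h4
      exact hF (Subtype.ext (Prod.ext h3 h4.symm))
    have hfix' : ∀ y, y ∉ Set.range e → σ y = y := fun y hy => by
      conv_lhs => rw [← hfix y hy]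
      exact σ.apply_symm_apply y
    have hmap : ∀ x, ∃ x', e x' = σ (e x) := fun x => by
      by_contra hx
      have h5 := hfix _ hx
      rw [show σ⁻¹ (σ (e x)) = e x from σ.symm_apply_apply _] at h5
      exact hx ⟨x, h5⟩
    choose τ hτ using hmap
    have hτi : Function.Injective τ := fun a b hab => by
      have : σ (e a) = σ (e b) := by rw [← hτ, hab, hτ]
      exact e.injective (σ.injective this)
    refine ⟨Equiv.ofBijective τ (Finite.injective_iff_bijective.1 hτi), by simp, ?_⟩
    ext y
    by_cases hy : y ∈ Set.range e
    · obtain ⟨x, rfl⟩ := hy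
      dsimp only
      rw [Equiv.Perm.viaEmbedding_apply, ← hτ]
      rfl
    · rw [Equiv.Perm.viaEmbedding_apply_of_notMem _ _ _ hy, hfix' y hy]
  · intro σ _
    rw [hmul]
    refine if_congr ?_ ?_ rfl
    · rw [Compat, Compat]
      refine and_congr ?_ ?_ <;> rw [hcases] <;>
        simp +contextual only [Equiv.Perm.viaEmbedding_apply, Function.comp_apply,
          Equiv.Perm.viaEmbedding_apply_of_notMem, not_false_eq_true, implies_true, and_true]
    · congr 2
      classical
      convert (Equiv.Perm.sign_extendDomain _ _).symm using 1
      rw [Equiv.Perm.viaEmbedding]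

end Compat

theorem sum_perm_comp_embedding {k N : ℕ} (e : Fin k ↪ Fin N) (W : (Fin k ↪ Fin N) → ℚ) :
    (N.descFactorial k : ℚ) * ∑ f : Equiv.Perm (Fin N), W (e.trans f.toEmbedding)
      = (N.factorial : ℚ) * ∑ F : Fin k ↪ Fin N, W F := by
  have hfib : ∀ F : Fin k ↪ Fin N,
      (Finset.univ.filter fun f : Equiv.Perm (Fin N) => e.trans f.toEmbedding = F).card
        = (Finset.univ.filter fun f : Equiv.Perm (Fin N) => e.trans f.toEmbedding = e).card := by
    intro F
    obtain ⟨g, hg⟩ := (Equiv.Perm.isMultiplyPretransitive (Fin N) k).exists_smul_eq e F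
    symm
    refine Finset.card_bij (fun f _ => g * f) ?_ (fun _ _ _ _ h => mul_left_cancel h) ?_
    · intro f hf
      simp only [Finset.mem_filter, Finset.mem_univ, true_and] at hf ⊢
      rw [← hg]
      conv_rhs => rw [← hf]
      rfl
    · intro f hf
      simp only [Finset.mem_filter, Finset.mem_univ, true_and] at hf ⊢
      refine ⟨g⁻¹ * f, ?_, by simp⟩
      have h : g⁻¹ • F = e := inv_smul_eq_iff.2 hg.symm
      rw [← hf] at h
      exact h
  set c := (Finset.univ.filter fun f : Equiv.Perm (Fin N) => e.trans f.toEmbedding = e).card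
  have key : ∀ W : (Fin k ↪ Fin N) → ℚ, ∑ f : Equiv.Perm (Fin N), W (e.trans f.toEmbedding)
      = c * ∑ F : Fin k ↪ Fin N, W F := fun W => by
    rw [← Finset.sum_fiberwise _ (fun f : Equiv.Perm (Fin N) => e.trans f.toEmbedding),
      Finset.mul_sum]
    refine Finset.sum_congr rfl fun F _ => ?_
    rw [Finset.sum_congr rfl (g := fun _ => W F) (fun f hf => by rw [(Finset.mem_filter.1 hf).2]),
      Finset.sum_const, hfib, nsmul_eq_mul]
  have h1 := key fun _ => 1
  simp only [Finset.sum_const, Finset.card_univ, Fintype.card_perm, Fintype.card_fin,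
    Fintype.card_embedding_eq, nsmul_eq_mul, mul_one] at h1
  rw [key, h1]
  ring

theorem coeff_youngSymmetrizer_conj (μ : YoungDiagram) (π g : Equiv.Perm (Fin μ.card)) :
    (youngSymmetrizer μ).coeff (g⁻¹ * π⁻¹ * g)
      = signedCount μ π (fun x => fill μ (g⁻¹ x)) := by
  rw [coeff_youngSymmetrizer, signedCount]
  refine Fintype.sum_equiv ((Equiv.inv _).trans (MulAut.conj g).toEquiv) _ _ fun q => ?_
  have hsign : Equiv.Perm.sign (((Equiv.inv _).trans (MulAut.conj g).toEquiv) q)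
      = Equiv.Perm.sign q := by
    simp [mul_comm, ← mul_assoc]
  refine if_congr ?_ (by rw [hsign]) rfl
  simp only [Equiv.trans_apply, Equiv.inv_apply, Compat, fill_fst]
  refine and_congr ?_ ?_
  · rw [show IsColPerm μ q ↔ IsColPerm μ q⁻¹ from ⟨fun h => h.inv, fun h => by simpa using h.inv⟩,
      IsColPerm, ← g⁻¹.forall_congr_right]
    simp [Equiv.Perm.mul_apply]
  · rw [show IsRowPerm μ (g⁻¹ * π⁻¹ * g * q⁻¹) ↔ IsRowPerm μ (g⁻¹ * π⁻¹ * g * q⁻¹)⁻¹ from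
        ⟨fun h => h.inv, fun h => by simpa using h.inv⟩,
      IsRowPerm, ← g⁻¹.forall_congr_right]
    simp [mul_assoc, Equiv.Perm.mul_apply]

theorem normChar_eq_sum_signedCount {k : ℕ} (μ : YoungDiagram) (π : Equiv.Perm (Fin k)) :
    normChar μ π = ∑ F : Fin k → μ.cells, signedCount μ π F := by
  have hinj : ∑ F : Fin k → μ.cells, signedCount μ π F
      = ∑ F : Fin k ↪ Fin μ.card, signedCount μ π (fun x => fill μ (F x)) := by
    symm
    refine Finset.sum_of_injOn (fun (F : Fin k ↪ Fin μ.card) x => fill μ (F x)) ?_ (by simp) ?_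
      (fun _ _ => rfl)
    · intro F _ G _ h
      ext x
      exact congrArg Fin.val ((fill μ).injective (congrFun h x))
    · intro F _ hF
      refine signedCount_eq_zero_of_not_injective _ fun hi => hF ?_
      exact ⟨⟨fun x => (fill μ).symm (F x), (fill μ).symm.injective.comp hi⟩, by simp,
        by ext x : 1; simp⟩
  rw [hinj, normChar]
  split_ifs with hk
  · have h0 : (μ.card.factorial : ℚ) ≠ 0 := by exact_mod_cast Nat.factorial_ne_zero _
    rw [mul_div_assoc, irrChar_div_irrChar_one, ← mul_div_assoc, div_eq_iff h0,
      mul_comm (Finset.sum _ _), ← sum_perm_comp_embedding (Fin.castLEEmb hk)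
        (fun F => signedCount μ π (fun x => fill μ (F x))),
      ← Equiv.sum_comp (Equiv.inv (Equiv.Perm (Fin μ.card)))]
    congr 1
    refine Finset.sum_congr rfl fun f _ => ?_
    rw [Equiv.inv_apply, coeff_youngSymmetrizer_conj, inv_inv]
    exact signedCount_viaEmbedding (Fin.castLEEmb hk) π ((fill μ).injective.comp f.injective)
  · have : IsEmpty (Fin k ↪ Fin μ.card) :=
      ⟨fun F => hk (by simpa using Fintype.card_le_of_embedding F)⟩
    simp

section CycleCount

variable {X Y : Type*}

/-- The number of orbits of a permutation. -/
noncomputable def cycleCount (σ : Equiv.Perm X) : ℕ :=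
  Nat.card (Quotient (Equiv.Perm.SameCycle.setoid σ))

theorem eq_of_sameCycle {α : Type*} {σ : Equiv.Perm X} {f : X → α} (hf : ∀ a, f (σ a) = f a)
    {a b : X} (h : σ.SameCycle a b) : f a = f b := by
  obtain ⟨i, rfl⟩ := h
  induction i using Int.induction_on with
  | zero => rfl
  | succ i ih => rw [add_comm, zpow_add, zpow_one, Equiv.Perm.mul_apply, hf, ih]
  | pred i ih =>
    rw [ih, ← hf ((σ ^ (-(i : ℤ) - 1)) a), ← Equiv.Perm.mul_apply, ← zpow_one_add]
    congr 3
    ring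

/-- Functions constant along the cycles of `σ` are functions on the set of cycles. -/
def invariantEquiv (σ : Equiv.Perm X) (α : Type*) :
    {f : X → α // ∀ a, f (σ a) = f a} ≃ (Quotient (Equiv.Perm.SameCycle.setoid σ) → α) where
  toFun f := Quotient.lift f.1 fun _ _ h => eq_of_sameCycle f.2 h
  invFun g := ⟨fun a => g ⟦a⟧, fun a => congrArg g (Quotient.sound (Equiv.Perm.sameCycle_apply_left.2
    (Equiv.Perm.SameCycle.refl σ a)))⟩
  left_inv f := rfl
  right_inv g := by
    ext q
    induction q using Quotient.inductionOn
    rfl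

variable [Finite X]

theorem card_invariant (σ : Equiv.Perm X) (α : Type*) [Finite α] :
    Nat.card {f : X → α // ∀ a, f (σ a) = f a} = Nat.card α ^ cycleCount σ := by
  rw [Nat.card_congr (invariantEquiv σ α), Nat.card_fun, cycleCount]

theorem cycleCount_eq_of_card {σ : Equiv.Perm X} {k : ℕ}
    (h : Nat.card {f : X → Bool // ∀ a, f (σ a) = f a} = 2 ^ k) : cycleCount σ = k := by
  rw [card_invariant, Nat.card_eq_fintype_card, Fintype.card_bool] at h
  exact Nat.pow_right_injective le_rfl h

theorem card_invariant_bool (σ : Equiv.Perm X) :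
    Nat.card {f : X → Bool // ∀ a, f (σ a) = f a} = 2 ^ cycleCount σ := by
  rw [card_invariant, Nat.card_eq_fintype_card, Fintype.card_bool]

theorem cycleCount_permCongr [Finite Y] (e : X ≃ Y) (σ : Equiv.Perm X) :
    cycleCount (e.permCongr σ) = cycleCount σ := by
  refine cycleCount_eq_of_card ?_
  rw [← card_invariant_bool]
  refine Nat.card_congr ((e.symm.arrowCongr (Equiv.refl Bool)).subtypeEquiv fun f => ?_)
  rw [← e.forall_congr_right]
  simp

theorem cycleCount_sumCongr [Finite Y] (σ : Equiv.Perm X) (τ : Equiv.Perm Y) :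
    cycleCount (Equiv.Perm.sumCongr σ τ) = cycleCount σ + cycleCount τ := by
  refine cycleCount_eq_of_card ?_
  rw [pow_add, ← card_invariant_bool, ← card_invariant_bool, ← Nat.card_prod]
  refine Nat.card_congr (((Equiv.sumArrowEquivProdArrow X Y Bool).subtypeEquiv fun f => ?_).trans
    (Equiv.subtypeProdEquivProd (p := fun f : X → Bool => ∀ a, f (σ a) = f a)
      (q := fun f : Y → Bool => ∀ a, f (τ a) = f a)))
  simp [Sum.forall]

theorem cycleCount_finRotate (m : ℕ) : cycleCount (finRotate (m + 1)) = 1 := by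
  refine cycleCount_eq_of_card ?_
  have h : ∀ f : Fin (m + 1) → Bool, (∀ a, f (finRotate (m + 1) a) = f a) ↔ ∃ b, (fun _ => b) = f :=
    fun f => by
      refine ⟨fun hf => ⟨f 0, funext fun a => ?_⟩, ?_⟩
      · induction a using Fin.induction with
        | zero => rfl
        | succ i ih =>
          rw [ih, ← hf, finRotate_apply, Fin.coeSucc_eq_succ]
      · rintro ⟨b, rfl⟩ _
        rfl
  simp_rw [h]
  rw [pow_one, ← Fintype.card_bool, ← Nat.card_eq_fintype_card]
  exact (Nat.card_congr (Equiv.ofInjective (fun b : Bool => fun _ : Fin (m + 1) => b)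
    fun a b hab => congrFun hab 0)).symm

end CycleCount

theorem mem_dilate {μ : YoungDiagram} {s : ℕ} (hs : 0 < s) {c : ℕ × ℕ} :
    c ∈ (dilate μ s).cells ↔ (c.1 / s, c.2 / s) ∈ μ.cells := by
  simp only [dilate, Finset.mem_filter, Finset.mem_product, Finset.mem_range, and_iff_right_iff_imp]
  intro h
  rw [mul_comm s, mul_comm s, ← Nat.div_lt_iff_lt_mul hs, ← Nat.div_lt_iff_lt_mul hs,
    ← YoungDiagram.mem_iff_lt_colLen, ← YoungDiagram.mem_iff_lt_rowLen]
  exact ⟨μ.isLowerSet (Prod.mk_le_mk.2 ⟨le_rfl, Nat.zero_le _⟩) h,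
    μ.isLowerSet (Prod.mk_le_mk.2 ⟨Nat.zero_le _, le_rfl⟩) h⟩

/-- A box of the dilated diagram is a box of the original one together with a position in the
`s × s` grid. -/
def dilateEquiv (μ : YoungDiagram) {s : ℕ} (hs : 0 < s) :
    (dilate μ s).cells ≃ μ.cells × Fin s × Fin s where
  toFun c := ⟨⟨_, (mem_dilate hs).1 c.2⟩, ⟨c.1.1 % s, Nat.mod_lt _ hs⟩, ⟨c.1.2 % s, Nat.mod_lt _ hs⟩⟩
  invFun p := ⟨(s * p.1.1.1 + p.2.1, s * p.1.1.2 + p.2.2), by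
    rw [mem_dilate hs]
    simp [Nat.mul_add_div hs, Nat.div_eq_of_lt]⟩
  left_inv c := by simp [Nat.div_add_mod]
  right_inv p := by simp [Nat.mul_add_div hs, Nat.div_eq_of_lt, Nat.mod_eq_of_lt]

theorem card_compat_dilate {X : Type*} [Finite X] (μ : YoungDiagram) {s : ℕ} (hs : 0 < s)
    (σ₁ σ₂ : Equiv.Perm X) :
    Nat.card {F : X → (dilate μ s).cells // Compat (dilate μ s) σ₁ σ₂ F}
      = Nat.card {F : X → μ.cells // Compat μ σ₁ σ₂ F} * s ^ (cycleCount σ₁ + cycleCount σ₂) := by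
  have h1 := card_invariant σ₁ (Fin s)
  have h2 := card_invariant σ₂ (Fin s)
  rw [Nat.card_fin] at h1 h2
  rw [add_comm, pow_add, ← h1, ← h2, ← Nat.card_prod, ← Nat.card_prod]
  let e : (X → (dilate μ s).cells) ≃ (X → μ.cells) × (X → Fin s) × (X → Fin s) :=
    (Equiv.arrowCongr (Equiv.refl X) (dilateEquiv μ hs)).trans
      ((Equiv.arrowProdEquivProdArrow _ _ _).trans
        (Equiv.prodCongr (Equiv.refl _) (Equiv.arrowProdEquivProdArrow _ _ _)))
  refine Nat.card_congr ((e.subtypeEquiv fun F => ?_).trans ((Equiv.subtypeProdEquivProd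
    (p := Compat μ σ₁ σ₂) (q := fun p : (X → Fin s) × (X → Fin s) =>
      (∀ a, p.1 (σ₂ a) = p.1 a) ∧ ∀ a, p.2 (σ₁ a) = p.2 a)).trans
    (Equiv.prodCongr (Equiv.refl _) (Equiv.subtypeProdEquivProd
      (p := fun f : X → Fin s => ∀ a, f (σ₂ a) = f a)
      (q := fun f : X → Fin s => ∀ a, f (σ₁ a) = f a)))))
  have hmod : ∀ a b : ℕ, a = b ↔ a / s = b / s ∧ a % s = b % s := fun a b =>
    ⟨fun h => by simp [h], fun h => by rw [← Nat.div_add_mod a s, h.1, h.2, Nat.div_add_mod]⟩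
  refine (and_congr (forall_congr' fun a => hmod _ _) (forall_congr' fun a => hmod _ _)).trans ?_
  simp only [forall_and]
  simp [e, dilateEquiv, Compat, Equiv.arrowProdEquivProdArrow]
  tauto

theorem normChar_dilate {k : ℕ} (μ : YoungDiagram) {s : ℕ} (hs : 0 < s) (π : Equiv.Perm (Fin k)) :
    normChar (dilate μ s) π = ∑ σ : Equiv.Perm (Fin k), ((Equiv.Perm.sign σ : ℤ) : ℚ) *
      Nat.card {F : Fin k → μ.cells // Compat μ σ (σ⁻¹ * π) F} *
        (s : ℚ) ^ (cycleCount σ + cycleCount (σ⁻¹ * π)) := by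
  rw [normChar_eq_sum_signedCount]
  simp_rw [signedCount]
  rw [Finset.sum_comm]
  refine Finset.sum_congr rfl fun σ _ => ?_
  rw [← Finset.sum_filter, Finset.sum_const, nsmul_eq_mul, ← Fintype.card_subtype,
    ← Nat.card_eq_fintype_card, card_compat_dilate μ hs]
  push_cast
  ring

section PlanarSum

variable {X : Type*} [Fintype X] [DecidableEq X]

/-- The signed, weighted count of coloured minimal factorizations of `π`. -/
noncomputable def planarSum (μ : YoungDiagram) (π : Equiv.Perm X) (w : (X → μ.cells) → ℚ) : ℚ :=
  ∑ σ : Equiv.Perm X,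
    if cycleCount σ + cycleCount (σ⁻¹ * π) = Fintype.card X + cycleCount π then
      ((Equiv.Perm.sign σ : ℤ) : ℚ) * ∑ F : X → μ.cells, if Compat μ σ (σ⁻¹ * π) F then w F else 0
    else 0

end PlanarSum

theorem freeCumulant_eq_planarSum (μ : YoungDiagram) (m : ℕ) :
    freeCumulant μ (m + 2) = planarSum μ (finRotate (m + 1)) fun _ => 1 := by
  set q : Polynomial ℚ := ∑ σ : Equiv.Perm (Fin (m + 1)), Polynomial.C
    (((Equiv.Perm.sign σ : ℤ) : ℚ) *
      Nat.card {F : Fin (m + 1) → μ.cells // Compat μ σ (σ⁻¹ * finRotate (m + 1)) F}) *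
        Polynomial.X ^ (cycleCount σ + cycleCount (σ⁻¹ * finRotate (m + 1))) with hq
  have h : ∀ s : ℕ, 0 < s →
      SigmaCycle (dilate μ s) (m + 2 - 1) = Polynomial.eval (s : ℚ) q := fun s hs => by
    rw [show m + 2 - 1 = m + 1 from rfl, SigmaCycle, normChar_dilate μ hs]
    simp [hq, Polynomial.eval_finsetSum]
  have h' : ∃ p : Polynomial ℚ, ∀ s : ℕ, 0 < s →
      SigmaCycle (dilate μ s) (m + 2 - 1) = Polynomial.eval (s : ℚ) p := ⟨q, h⟩
  have hpq : h'.choose = q := by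
    refine Polynomial.eq_of_infinite_eval_eq _ _ (Set.Infinite.mono (s := Set.range
      fun s : ℕ => ((s + 1 : ℕ) : ℚ)) ?_ (Set.infinite_range_of_injective fun a b hab => ?_))
    · rintro _ ⟨s, rfl⟩
      exact (h'.choose_spec _ s.succ_pos).symm.trans (h _ s.succ_pos)
    · simpa using hab
  rw [freeCumulant, dif_pos h', hpq, hq, Polynomial.finsetSum_coeff, planarSum]
  refine Finset.sum_congr rfl fun σ _ => ?_
  rw [Polynomial.coeff_C_mul_X_pow, cycleCount_finRotate, Fintype.card_fin]
  refine if_congr eq_comm ?_ rfl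
  rw [← Finset.sum_filter, Finset.sum_const, nsmul_eq_mul, ← Fintype.card_subtype,
    Nat.card_eq_fintype_card, mul_one]

section Genus

variable {X Y : Type*}

/-- The linear operator `f ↦ f ∘ σ - f`. -/
def permDiff (σ : Equiv.Perm X) : (X → ℚ) →ₗ[ℚ] (X → ℚ) :=
  LinearMap.funLeft ℚ ℚ σ - LinearMap.id

theorem permDiff_apply (σ : Equiv.Perm X) (f : X → ℚ) (x : X) :
    permDiff σ f x = f (σ x) - f x := rfl

theorem finrank_range_permDiff [Fintype X] (σ : Equiv.Perm X) :
    Module.finrank ℚ (LinearMap.range (permDiff σ)) + cycleCount σ = Fintype.card X := by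
  have hmem : ∀ f, f ∈ LinearMap.ker (permDiff σ) ↔ ∀ a, f (σ a) = f a := fun f => by
    rw [LinearMap.mem_ker, funext_iff]
    exact forall_congr' fun a => by rw [permDiff_apply, Pi.zero_apply, sub_eq_zero]
  let e : LinearMap.ker (permDiff σ) ≃ₗ[ℚ] (Quotient (Equiv.Perm.SameCycle.setoid σ) → ℚ) :=
    LinearEquiv.symm
      { toFun := fun g => ⟨fun a => g ⟦a⟧, (hmem _).2 ((invariantEquiv σ ℚ).symm g).2⟩
        map_add' := fun _ _ => rfl
        map_smul' := fun _ _ => rfl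
        invFun := fun f => invariantEquiv σ ℚ ⟨f.1, (hmem _).1 f.2⟩
        left_inv := fun g => (invariantEquiv σ ℚ).apply_symm_apply g
        right_inv := fun _ => rfl }
  have h1 : Module.finrank ℚ (LinearMap.ker (permDiff σ)) = cycleCount σ := by
    classical
    rw [e.finrank_eq, Module.finrank_fintype_fun_eq_card, cycleCount, Nat.card_eq_fintype_card]
  rw [← h1, LinearMap.finrank_range_add_finrank_ker, Module.finrank_fintype_fun_eq_card]

theorem range_permDiff_mul_le (σ τ : Equiv.Perm X) :
    LinearMap.range (permDiff (σ * τ))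
      ≤ LinearMap.range (permDiff σ) ⊔ LinearMap.range (permDiff τ) := by
  rintro _ ⟨f, rfl⟩
  refine Submodule.mem_sup.2 ⟨_, ⟨f, rfl⟩, _, ⟨f ∘ σ, rfl⟩, ?_⟩
  ext x
  simp only [Pi.add_apply, permDiff_apply, Function.comp_apply, Equiv.Perm.mul_apply]
  ring

variable [Fintype X] [Fintype Y]

theorem cycleCount_add_le (σ π : Equiv.Perm X) :
    cycleCount σ + cycleCount (σ⁻¹ * π) ≤ Fintype.card X + cycleCount π := by
  have h1 := Submodule.finrank_mono (range_permDiff_mul_le σ (σ⁻¹ * π))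
  have h2 := Submodule.finrank_add_le_finrank_add_finrank (LinearMap.range (permDiff σ))
    (LinearMap.range (permDiff (σ⁻¹ * π)))
  rw [mul_inv_cancel_left] at h1
  have h3 := finrank_range_permDiff σ
  have h4 := finrank_range_permDiff (σ⁻¹ * π)
  have h5 := finrank_range_permDiff π
  omega

/-- In a minimal factorization of `π`, the factors preserve the cycles of `π`. -/
theorem invariant_of_minimal {σ π : Equiv.Perm X}
    (h : cycleCount σ + cycleCount (σ⁻¹ * π) = Fintype.card X + cycleCount π)
    {g : X → ℚ} (hg : ∀ a, g (π a) = g a) (a : X) : g (σ a) = g a := by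
  classical
  have hle : LinearMap.range (permDiff σ) ≤ LinearMap.range (permDiff π) := by
    have h1 := range_permDiff_mul_le σ (σ⁻¹ * π)
    have h2 := Submodule.finrank_add_le_finrank_add_finrank (LinearMap.range (permDiff σ))
      (LinearMap.range (permDiff (σ⁻¹ * π)))
    rw [mul_inv_cancel_left] at h1
    have h3 := finrank_range_permDiff σ
    have h4 := finrank_range_permDiff (σ⁻¹ * π)
    have h5 := finrank_range_permDiff π
    rw [Submodule.eq_of_le_of_finrank_le h1 (by omega)]
    exact le_sup_left
  obtain ⟨f, hf⟩ := hle ⟨Pi.single (σ a) 1, rfl⟩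
  have h0 : ∑ x, g x * permDiff π f x = 0 := by
    simp only [permDiff_apply, mul_sub, Finset.sum_sub_distrib]
    rw [← Equiv.sum_comp π fun x => g x * f x]
    simp [hg]
  rw [hf] at h0
  simp only [permDiff_apply, mul_sub, Finset.sum_sub_distrib, Pi.single_apply,
    EmbeddingLike.apply_eq_iff_eq, mul_ite, mul_one, mul_zero, Finset.sum_ite_eq',
    Finset.mem_univ, if_true] at h0
  linarith

variable [DecidableEq X] [DecidableEq Y]

theorem planarSum_permCongr (μ : YoungDiagram) (e : X ≃ Y) (π : Equiv.Perm X)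
    (w : (Y → μ.cells) → ℚ) :
    planarSum μ (e.permCongr π) w = planarSum μ π fun F => w (F ∘ e.symm) := by
  rw [planarSum, planarSum]
  symm
  refine Fintype.sum_equiv e.permCongr _ _ fun σ => ?_
  have h : (e.permCongr σ)⁻¹ * e.permCongr π = e.permCongr (σ⁻¹ * π) := by
    rw [inv_mul_eq_iff_eq_mul]
    ext x
    simp [Equiv.Perm.mul_apply, Equiv.permCongr_apply]
  rw [h, cycleCount_permCongr, cycleCount_permCongr, cycleCount_permCongr,
    Fintype.card_congr e, Equiv.Perm.sign_permCongr]
  refine if_congr Iff.rfl ?_ rfl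
  congr 1
  refine Fintype.sum_equiv (e.arrowCongr (Equiv.refl _)) _ _ fun F => ?_
  refine if_congr ?_ rfl rfl
  rw [Compat, Compat, ← e.forall_congr_right, ← e.forall_congr_right]
  simp [Equiv.permCongr_apply]

theorem planarSum_sumCongr (μ : YoungDiagram) (π₁ : Equiv.Perm X) (π₂ : Equiv.Perm Y)
    (w₁ : (X → μ.cells) → ℚ) (w₂ : (Y → μ.cells) → ℚ) :
    planarSum μ (Equiv.Perm.sumCongr π₁ π₂)
        (fun F => w₁ (F ∘ Sum.inl) * w₂ (F ∘ Sum.inr))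
      = planarSum μ π₁ w₁ * planarSum μ π₂ w₂ := by
  have hmul : ∀ (σ₁ : Equiv.Perm X) (σ₂ : Equiv.Perm Y),
      (Equiv.Perm.sumCongr σ₁ σ₂)⁻¹ * Equiv.Perm.sumCongr π₁ π₂
        = Equiv.Perm.sumCongr (σ₁⁻¹ * π₁) (σ₂⁻¹ * π₂) := fun σ₁ σ₂ => by
    rw [Equiv.Perm.sumCongr_inv, Equiv.Perm.sumCongr_mul]
  rw [planarSum, planarSum, planarSum, Finset.sum_mul_sum, ← Finset.sum_product']
  symm
  refine Finset.sum_of_injOn (fun p => Equiv.Perm.sumCongr p.1 p.2)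
    (Equiv.Perm.sumCongrHom_injective (α := X) (β := Y)).injOn (by simp) ?_ ?_
  · intro σ _ hσ
    refine if_neg fun hmin => hσ ?_
    have hinv := invariant_of_minimal hmin (g := Sum.elim (fun _ => 1) fun _ => 0)
      (by rintro (a | a) <;> simp)
    have hmaps : Set.MapsTo σ (Set.range Sum.inl) (Set.range Sum.inl) := by
      rintro _ ⟨a, rfl⟩
      have := hinv (Sum.inl a)
      generalize σ (Sum.inl a) = b at *
      rcases b with b | b
      · exact ⟨b, rfl⟩
      · simp at this
    obtain ⟨p, hp⟩ := Equiv.Perm.mem_sumCongrHom_range_of_perm_mapsTo_inl hmaps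
    exact ⟨p, by simp, hp⟩
  · rintro ⟨σ₁, σ₂⟩ _
    dsimp only
    rw [hmul]
    simp only [cycleCount_sumCongr, Fintype.card_sum, Equiv.Perm.sign_sumCongr]
    have h1 := cycleCount_add_le σ₁ π₁
    have h2 := cycleCount_add_le σ₂ π₂
    rw [ite_zero_mul_ite_zero]
    refine if_congr ⟨fun h => by omega, fun h => by omega⟩ ?_ rfl
    push_cast
    rw [mul_mul_mul_comm, Finset.sum_mul_sum, ← Finset.sum_product']
    congr 1
    refine Fintype.sum_equiv (Equiv.sumArrowEquivProdArrow X Y μ.cells).symm _ _ fun p => ?_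
    rw [ite_zero_mul_ite_zero]
    refine if_congr ?_ rfl rfl
    simp only [Compat, Sum.forall]
    simp
    tauto

end Genus

section RemovePoint

variable {X : Type*} [DecidableEq X]

theorem invariant_swap_mul_optionCongr {α : Type*} (q : Option X) (ρ : Equiv.Perm X)
    (f : Option X → α) :
    (∀ a, f ((Equiv.swap none q * Equiv.optionCongr ρ) a) = f a)
      ↔ f q = f none ∧ ∀ x, f (some (ρ x)) = f (some x) := by
  have hsw : f q = f none → ∀ y, f (Equiv.swap none q y) = f y := fun h y => by
    rw [Equiv.swap_apply_def]; split_ifs with h1 h2 <;> simp [*]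
  constructor
  · intro h
    have h0 : f q = f none := by simpa using h none
    refine ⟨h0, fun x => ?_⟩
    have := h (some x)
    rwa [Equiv.Perm.mul_apply, hsw h0] at this
  · rintro ⟨h0, h⟩ (_ | x)
    · simpa using h0
    · rw [Equiv.Perm.mul_apply, hsw h0]
      exact h x

theorem cycleCount_swap_mul_optionCongr [Finite X] (q : Option X) (ρ : Equiv.Perm X) :
    cycleCount (Equiv.swap none q * Equiv.optionCongr ρ)
      = cycleCount ρ + if q = none then 1 else 0 := by
  refine cycleCount_eq_of_card ?_
  simp only [invariant_swap_mul_optionCongr]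
  rcases q with _ | y
  · rw [if_pos rfl, pow_succ', ← card_invariant_bool, ← Fintype.card_bool,
      ← Nat.card_eq_fintype_card, ← Nat.card_prod]
    refine Nat.card_congr
      { toFun := fun f => (f.1 none, ⟨fun x => f.1 (some x), f.2.2⟩)
        invFun := fun p => ⟨fun o => o.elim p.1 p.2.1, rfl, p.2.2⟩
        left_inv := fun f => Subtype.ext (funext fun o => by cases o <;> rfl)
        right_inv := fun p => rfl }
  · rw [if_neg (by simp), add_zero, ← card_invariant_bool]
    refine Nat.card_congr
      { toFun := fun f => ⟨fun x => f.1 (some x), f.2.2⟩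
        invFun := fun p => ⟨fun o => o.elim (p.1 y) p.1, rfl, p.2⟩
        left_inv := fun f => Subtype.ext (funext fun o => by
          cases o
          · exact f.2.1
          · rfl)
        right_inv := fun p => rfl }

variable [Fintype X]

/-- Summation over a distinguished point: the point is removed from a minimal factorization. -/
theorem planarSum_option (μ : YoungDiagram) {π : Equiv.Perm (Option X)} {q : Option X → Option X}
    {π' : Option X → Equiv.Perm X}
    (hπ : ∀ p, π = Equiv.swap none p * (Equiv.swap none (q p) * Equiv.optionCongr (π' p)))
    (hc : ∀ p, cycleCount (π' p) + (if p = none then 1 else 0) + (if q p = none then 1 else 0)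
      = cycleCount π + 1)
    (w : (Option X → μ.cells) → ℚ) :
    planarSum μ π w = ∑ p, (if p = none then 1 else -1) * planarSum μ (π' p) fun F =>
      ∑ c : μ.cells,
        if (p.elim c F).1.2 = c.1.2 ∧ (((Equiv.optionCongr (π' p)).symm (q p)).elim c F).1.1 = c.1.1
        then w (fun o => o.elim c F) else 0 := by
  have hσ : ∀ p (σ : Equiv.Perm X), (Equiv.swap none p * Equiv.optionCongr σ)⁻¹ * π
      = Equiv.swap none ((Equiv.optionCongr σ⁻¹) (q p)) * Equiv.optionCongr (σ⁻¹ * π' p) := by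
    intro p σ
    have h1 : (Equiv.optionCongr σ)⁻¹ = Equiv.optionCongr σ⁻¹ := by
      ext1 x; cases x <;> rfl
    have h2 : Equiv.optionCongr (σ⁻¹ * π' p)
        = Equiv.optionCongr σ⁻¹ * Equiv.optionCongr (π' p) := by
      ext1 x; cases x <;> rfl
    rw [h2, ← mul_assoc, show (none : Option X) = Equiv.optionCongr σ⁻¹ none from rfl,
      ← Equiv.mul_swap_eq_swap_mul]
    conv_lhs => rw [hπ p]
    rw [mul_inv_rev, h1, Equiv.swap_inv, mul_assoc, ← mul_assoc (Equiv.swap _ _) (Equiv.swap _ _)]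
    simp [mul_assoc]
  have hnone : ∀ p (σ : Equiv.Perm X), (Equiv.optionCongr σ⁻¹) (q p) = none ↔ q p = none :=
    fun p σ => by cases q p <;> simp
  rw [planarSum, ← Equiv.sum_comp Equiv.Perm.decomposeOption.symm, Fintype.sum_prod_type]
  refine Finset.sum_congr rfl fun p _ => ?_
  rw [planarSum, Finset.mul_sum]
  refine Finset.sum_congr rfl fun σ _ => ?_
  have hsign : ((Equiv.Perm.sign (Equiv.swap none p * Equiv.optionCongr σ) : ℤˣ) : ℤ)
      = (if p = none then (1 : ℤ) else -1) * (Equiv.Perm.sign σ : ℤ) := by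
    rw [Equiv.Perm.sign_mul, Equiv.optionCongr_sign, Equiv.Perm.sign_swap']
    simp only [eq_comm (a := p)]
    split_ifs <;> simp
  rw [Equiv.Perm.decomposeOption_symm_apply, hσ, hsign,
    cycleCount_swap_mul_optionCongr, cycleCount_swap_mul_optionCongr, mul_ite, mul_zero]
  simp only [hnone]
  rw [Fintype.card_option]
  have hcp := hc p
  refine if_congr ⟨fun h => by omega, fun h => by omega⟩ ?_ rfl
  rw [← mul_assoc]
  push_cast
  congr 1
  rw [← Equiv.sum_comp (Equiv.piOptionEquivProd (β := fun _ : Option X => μ.cells)).symm,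
    Fintype.sum_prod_type, Finset.sum_comm]
  refine Finset.sum_congr rfl fun F _ => ?_
  by_cases hF : Compat μ σ (σ⁻¹ * π' p) F
  · rw [if_pos hF]
    refine Finset.sum_congr rfl fun c _ => ?_
    have hrow : ((((Equiv.optionCongr σ⁻¹) (q p)).elim c F).1.1 : ℕ)
        = (((Equiv.optionCongr (π' p)).symm (q p)).elim c F).1.1 := by
      cases hq : q p with
      | none => rfl
      | some y =>
        have h := hF.2 ((π' p).symm y)
        rw [Equiv.Perm.mul_apply, Equiv.apply_symm_apply] at h
        exact h
    have he : (Equiv.piOptionEquivProd (β := fun _ : Option X => μ.cells)).symm (c, F)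
        = fun o => o.elim c F := by
      ext1 o; cases o <;> rfl
    rw [he]
    refine if_congr ?_ rfl rfl
    rw [Compat, invariant_swap_mul_optionCongr p σ fun o => (o.elim c F).1.2,
      invariant_swap_mul_optionCongr _ _ fun o => (o.elim c F).1.1, hrow]
    exact ⟨fun h => ⟨h.1.1, h.2.1⟩, fun h => ⟨⟨h.1, hF.1⟩, ⟨h.2, hF.2⟩⟩⟩
  · rw [if_neg hF]
    refine Finset.sum_eq_zero fun c _ => if_neg fun h => hF ?_
    have he : (Equiv.piOptionEquivProd (β := fun _ : Option X => μ.cells)).symm (c, F)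
        = fun o => o.elim c F := by
      ext1 o; cases o <;> rfl
    rw [he, Compat, invariant_swap_mul_optionCongr p σ fun o => (o.elim c F).1.2,
      invariant_swap_mul_optionCongr _ _ fun o => (o.elim c F).1.1] at h
    exact ⟨h.1.2, h.2.2⟩

end RemovePoint

theorem planarSum_sum {X ι : Type*} [Fintype X] [DecidableEq X] (μ : YoungDiagram)
    (π : Equiv.Perm X) (s : Finset ι) (w : ι → (X → μ.cells) → ℚ) :
    planarSum μ π (fun F => ∑ i ∈ s, w i F) = ∑ i ∈ s, planarSum μ π (w i) := by
  simp only [planarSum]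
  rw [Finset.sum_comm]
  refine Finset.sum_congr rfl fun σ _ => ?_
  split_ifs
  · rw [← Finset.mul_sum, Finset.sum_comm]
    congr 1
    refine Finset.sum_congr rfl fun F _ => ?_
    split_ifs <;> simp
  · simp

theorem val_finRotate {n : ℕ} (a : Fin n) :
    (finRotate n a : ℕ) = if (a : ℕ) + 1 = n then 0 else (a : ℕ) + 1 := by
  cases n with
  | zero => exact a.elim0
  | succ n =>
    rcases eq_or_ne a (Fin.last n) with rfl | h
    · simp
    · rw [coe_finRotate_of_ne_last h, if_neg]
      intro h'
      exact h (Fin.ext (by simpa using h'))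

/-- The concatenation of two blocks. -/
def blockEquiv {m k : ℕ} (hk : k ≤ m) : Fin k ⊕ Fin (m - k) ≃ Fin m :=
  finSumFinEquiv.trans (finCongr (Nat.add_sub_cancel' hk))

/-- The permutation rotating `{0, …, k - 1}` and `{k, …, m - 1}`. -/
def blockRotate {m k : ℕ} (hk : k ≤ m) : Equiv.Perm (Fin m) :=
  (blockEquiv hk).permCongr (Equiv.Perm.sumCongr (finRotate k) (finRotate (m - k)))

theorem val_blockRotate {m k : ℕ} (hk : k ≤ m) (x : Fin m) :
    (blockRotate hk x : ℕ) = if (x : ℕ) < k then (if (x : ℕ) + 1 = k then 0 else (x : ℕ) + 1)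
      else (if (x : ℕ) + 1 = m then k else (x : ℕ) + 1) := by
  obtain ⟨y, rfl⟩ := (blockEquiv hk).surjective x
  rw [blockRotate, Equiv.permCongr_apply, Equiv.symm_apply_apply]
  rcases y with y | y
  · have := y.2
    simp [blockEquiv, val_finRotate, -finRotate_apply]
  · have := y.2
    simp [blockEquiv, val_finRotate, -finRotate_apply]
    split_ifs <;> omega

theorem cycleCount_blockRotate {m k : ℕ} (hk : k ≤ m) :
    cycleCount (blockRotate hk) + (if k = m then 1 else 0) + (if k = 0 then 1 else 0) = 2 := by
  have h : ∀ n, cycleCount (finRotate n) = if n = 0 then 0 else 1 := fun n => by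
    cases n with
    | zero => exact cycleCount_eq_of_card (by simp)
    | succ n => rw [cycleCount_finRotate]; rfl
  rw [blockRotate, cycleCount_permCongr, cycleCount_sumCongr, h, h]
  split_ifs <;> omega

/-- Minimal coloured factorizations of a cycle with a prescribed box at the last point. -/
noncomputable def boxSum (μ : YoungDiagram) (m : ℕ) (c : μ.cells) : ℚ :=
  planarSum μ (finRotate (m + 1)) fun F => if F (Fin.last m) = c then 1 else 0

/-- Minimal coloured factorizations of a cycle with a prescribed column at the first point. -/
noncomputable def colSum (μ : YoungDiagram) (l j : ℕ) : ℚ :=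
  planarSum μ (finRotate l) fun F => if ∀ a : Fin l, (a : ℕ) = 0 → (F a).1.2 = j then 1 else 0

/-- Minimal coloured factorizations of a cycle with a prescribed row at the last point. -/
noncomputable def rowSum (μ : YoungDiagram) (k i : ℕ) : ℚ :=
  planarSum μ (finRotate k) fun F => if ∀ a : Fin k, (a : ℕ) + 1 = k → (F a).1.1 = i then 1 else 0

theorem colSum_zero (μ : YoungDiagram) (j : ℕ) : colSum μ 0 j = 1 := by
  have h : ∀ σ : Equiv.Perm (Fin 0), cycleCount σ = 0 := fun σ => cycleCount_eq_of_card (by simp)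
  simp [colSum, planarSum, h, Compat]

theorem rowSum_zero (μ : YoungDiagram) (i : ℕ) : rowSum μ 0 i = 1 := by
  have h : ∀ σ : Equiv.Perm (Fin 0), cycleCount σ = 0 := fun σ => cycleCount_eq_of_card (by simp)
  simp [rowSum, planarSum, h, Compat]

theorem planarSum_one (μ : YoungDiagram) (m : ℕ) :
    planarSum μ (finRotate (m + 1)) (fun _ => 1) = ∑ c, boxSum μ m c := by
  simp only [boxSum]
  rw [← planarSum_sum]
  simp

theorem rowSum_succ (μ : YoungDiagram) (m i : ℕ) :
    rowSum μ (m + 1) i = ∑ c : μ.cells, if c.1.1 = i then boxSum μ m c else 0 := by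
  rw [← Finset.sum_filter]
  simp only [boxSum]
  rw [← planarSum_sum, rowSum]
  congr 1
  ext F
  rw [Finset.sum_ite_eq]
  refine if_congr ?_ rfl rfl
  simp only [Finset.mem_filter, Finset.mem_univ, true_and]
  refine ⟨fun h => h _ (by simp), fun h a ha => ?_⟩
  rwa [show a = Fin.last m from Fin.ext (by simpa using ha)]

theorem colSum_succ (μ : YoungDiagram) (m j : ℕ) :
    colSum μ (m + 1) j = ∑ c : μ.cells, if c.1.2 = j then boxSum μ m c else 0 := by
  rw [← Finset.sum_filter]
  simp only [boxSum]
  rw [← planarSum_sum, colSum]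
  have h : (finRotate (m + 1)).permCongr (finRotate (m + 1)) = finRotate (m + 1) := by
    ext x; simp
  conv_lhs => rw [← h, planarSum_permCongr]
  congr 1
  ext F
  rw [Finset.sum_ite_eq]
  refine if_congr ?_ rfl rfl
  have h0 : (finRotate (m + 1)).symm 0 = Fin.last m := by
    rw [Equiv.symm_apply_eq, finRotate_last]
  simp only [Finset.mem_filter, Finset.mem_univ, true_and, Function.comp_apply]
  refine ⟨fun h => h0 ▸ h 0 rfl, fun h a ha => ?_⟩
  rwa [show a = 0 from Fin.ext ha, h0]

/-- The position of a point, the adjoined point being the last one. -/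
def pos {m : ℕ} (o : Option (Fin m)) : ℕ := (finSuccEquivLast.symm o : Fin (m + 1))

theorem pos_injective {m : ℕ} : Function.Injective (pos (m := m)) := fun _ _ h =>
  finSuccEquivLast.symm.injective (Fin.ext h)

@[simp] theorem pos_none {m : ℕ} : pos (none : Option (Fin m)) = m := by simp [pos]

@[simp] theorem pos_some {m : ℕ} (x : Fin m) : pos (some x) = x := by simp [pos]

theorem pos_le {m : ℕ} (o : Option (Fin m)) : pos o ≤ m :=
  Nat.lt_succ_iff.1 (finSuccEquivLast.symm o : Fin (m + 1)).2

theorem pos_eq_iff {m : ℕ} (o : Option (Fin m)) : pos o = m ↔ o = none :=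
  ⟨fun h => pos_injective (h.trans pos_none.symm), fun h => by rw [h, pos_none]⟩

theorem pos_swap {m : ℕ} (p o : Option (Fin m)) :
    pos (Equiv.swap none p o) = if pos o = m then pos p else if pos o = pos p then m else pos o := by
  rw [Equiv.swap_apply_def]
  simp only [pos_eq_iff, pos_injective.eq_iff]
  split_ifs <;> simp

/-- The first point of the first block. -/
def firstOfBlock {m : ℕ} (p : Option (Fin m)) : Option (Fin m) :=
  if pos p = 0 then none else finSuccEquivLast 0

theorem pos_firstOfBlock {m : ℕ} (p : Option (Fin m)) :
    pos (firstOfBlock p) = if pos p = 0 then m else 0 := by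
  rw [firstOfBlock]
  split_ifs
  · simp
  · simp [pos]

theorem permCongr_finRotate_eq {m : ℕ} (p : Option (Fin m)) :
    finSuccEquivLast.permCongr (finRotate (m + 1))
      = Equiv.swap none p * (Equiv.swap none (firstOfBlock p) *
        Equiv.optionCongr (blockRotate (pos_le p))) := by
  ext1 o
  apply pos_injective
  rw [Equiv.Perm.mul_apply, Equiv.Perm.mul_apply, pos_swap, pos_swap, pos_firstOfBlock]
  have h1 : pos (finSuccEquivLast.permCongr (finRotate (m + 1)) o)
      = if pos o = m then 0 else pos o + 1 := by
    rw [pos, Equiv.permCongr_apply, Equiv.symm_apply_apply, val_finRotate]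
    exact if_congr (by simp [pos]) rfl rfl
  have h2 := pos_le p
  rw [h1]
  cases o with
  | none =>
    rw [Equiv.optionCongr_apply, Option.map_none, pos_none]
    split_ifs <;> omega
  | some x =>
    have hx := x.2
    rw [Equiv.optionCongr_apply, Option.map_some]
    simp only [pos_some, val_blockRotate]
    clear h1
    generalize hy : (if (x : ℕ) < pos p then if (x : ℕ) + 1 = pos p then 0 else (x : ℕ) + 1
      else if (x : ℕ) + 1 = m then pos p else (x : ℕ) + 1) = y
    generalize hq : (if pos p = 0 then m else 0) = q
    split_ifs at hy hq ⊢ <;> omega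

theorem boxSum_eq (μ : YoungDiagram) (m : ℕ) (c : μ.cells) :
    boxSum μ m c = ∑ k ∈ Finset.range (m + 1),
      (if k = m then 1 else -1) * (rowSum μ k c.1.1 * colSum μ (m - k) c.1.2) := by
  have h1 : boxSum μ m c = planarSum μ (finSuccEquivLast.permCongr (finRotate (m + 1)))
      fun F => if F none = c then 1 else 0 := by
    rw [planarSum_permCongr, boxSum]
    simp
  have hq : ∀ p : Option (Fin m), firstOfBlock p = none ↔ pos p = 0 := fun p => by
    have := pos_le p
    rw [← pos_eq_iff, pos_firstOfBlock]
    split_ifs <;> omega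
  rw [h1, planarSum_option μ permCongr_finRotate_eq, Finset.sum_range,
    ← Equiv.sum_comp finSuccEquivLast.symm]
  · refine Finset.sum_congr rfl fun p _ => ?_
    change _ = (if pos p = m then 1 else -1) * (rowSum μ (pos p) _ * colSum μ (m - pos p) _)
    simp only [pos_eq_iff]
    congr 1
    have hp := pos_le p
    rw [rowSum, colSum, ← planarSum_sumCongr]
    rw [blockRotate, planarSum_permCongr]
    congr 1
    ext F
    rw [Finset.sum_eq_single c (fun b _ hb => by simp [hb]) (by simp), ite_zero_mul_ite_zero,
      if_pos (show (none : Option (Fin m)).elim c (F ∘ (blockEquiv hp).symm) = c from rfl), mul_one]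
    refine if_congr (and_comm.trans (and_congr ?_ ?_)) rfl rfl
    · by_cases h0 : pos p = 0
      · rw [(hq p).2 h0]
        exact ⟨fun _ a => absurd a.2 (by omega), fun _ => rfl⟩
      · have hs : (Equiv.optionCongr (blockRotate hp)).symm (firstOfBlock p)
            = some (blockEquiv hp (Sum.inl ⟨pos p - 1, by omega⟩)) := by
          rw [Equiv.symm_apply_eq]
          apply pos_injective
          rw [Equiv.optionCongr_apply, Option.map_some, pos_some, val_blockRotate,
            pos_firstOfBlock]
          simp only [blockEquiv, Equiv.trans_apply, finSumFinEquiv_apply_left, finCongr_apply,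
            Fin.val_cast, Fin.val_castAdd]
          split_ifs <;> omega
        rw [blockRotate] at hs
        rw [hs, Option.elim_some, Function.comp_apply, Equiv.symm_apply_apply]
        refine ⟨fun h a ha => ?_, fun h => h _ (Nat.sub_add_cancel (Nat.pos_of_ne_zero h0))⟩
        rw [← h, Function.comp_apply]
        congr 4
        exact Fin.ext (by dsimp only; omega)
    · have helim : ∀ (o : Option (Fin m)) (G : Fin m → μ.cells), p = o →
          p.elim c G = o.elim c G := by
        rintro _ _ rfl
        rfl
      by_cases h0 : pos p = m
      · rw [helim _ _ ((pos_eq_iff p).1 h0)]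
        exact ⟨fun _ a => absurd a.2 (by omega), fun _ => rfl⟩
      · have hs : p = some (blockEquiv hp (Sum.inr ⟨0, by omega⟩)) := by
          apply pos_injective
          simp [blockEquiv]
        rw [helim _ _ hs, Option.elim_some, Function.comp_apply, Equiv.symm_apply_apply]
        refine ⟨fun h a ha => ?_, fun h => h _ rfl⟩
        rw [← h, Function.comp_apply]
        congr 4
        exact Fin.ext ha
  · intro p
    rw [cycleCount_permCongr, cycleCount_finRotate, one_add_one_eq_two,
      ← cycleCount_blockRotate (pos_le p)]
    simp only [hq, pos_eq_iff]

section GeneratingSeries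

open PowerSeries

/-- One minus the generating series of `colSum` without its constant term. -/
noncomputable def colSeries (μ : YoungDiagram) (j : ℕ) : ℚ⟦X⟧ :=
  mk fun l => if l = 0 then 1 else -colSum μ l j

/-- The generating series of `rowSum`. -/
noncomputable def rowSeries (μ : YoungDiagram) (i : ℕ) : ℚ⟦X⟧ := mk fun k => rowSum μ k i

theorem mk_boxSum (μ : YoungDiagram) (c : μ.cells) :
    (mk fun m => boxSum μ m c) = rowSeries μ c.1.1 * colSeries μ c.1.2 := by
  ext m
  rw [coeff_mk, boxSum_eq, coeff_mul, Finset.Nat.sum_antidiagonal_eq_sum_range_succ_mk]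
  refine Finset.sum_congr rfl fun k hk => ?_
  have hk' := Finset.mem_range.1 hk
  rw [rowSeries, colSeries, coeff_mk, coeff_mk]
  rcases eq_or_ne k m with rfl | hkm
  · simp [colSum_zero]
  · have : m - k ≠ 0 := by omega
    simp [hkm, this]

theorem sum_cells_rows (μ : YoungDiagram) (f : ℕ → ℕ → ℚ⟦X⟧) (ℓ : ℕ) (hℓ : μ.colLen 0 ≤ ℓ) :
    ∑ c : μ.cells, f c.1.1 c.1.2 =
      ∑ i ∈ Finset.range ℓ, ∑ j ∈ Finset.range (μ.rowLen i), f i j := by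
  rw [Finset.sum_coe_sort μ.cells fun c => f c.1 c.2, Finset.sum_sigma']
  refine Finset.sum_bij' (fun c _ => ⟨c.1, c.2⟩) (fun c _ => (c.1, c.2)) ?_ ?_ ?_ ?_ ?_
  · rintro ⟨i, j⟩ h
    have h1 := YoungDiagram.mem_iff_lt_rowLen.1 (YoungDiagram.mem_cells _ |>.1 h)
    have h2 := YoungDiagram.mem_iff_lt_colLen.1 (YoungDiagram.mem_cells _ |>.1 h)
    have h3 := μ.colLen_anti 0 j (Nat.zero_le _)
    simp only [Finset.mem_sigma, Finset.mem_range]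
    omega
  · rintro ⟨i, j⟩ h
    simp only [Finset.mem_sigma, Finset.mem_range] at h
    exact YoungDiagram.mem_iff_lt_rowLen.2 h.2
  all_goals simp

theorem rowSeries_eq (μ : YoungDiagram) (i : ℕ) :
    rowSeries μ i = 1 + X * rowSeries μ i *
      ∑ j ∈ Finset.range (μ.rowLen i), colSeries μ j := by
  have h : ∑ c : μ.cells, (if c.1.1 = i then mk fun m => boxSum μ m c else 0) =
      rowSeries μ i * ∑ j ∈ Finset.range (μ.rowLen i), colSeries μ j := by
    simp_rw [mk_boxSum]
    rw [sum_cells_rows μ (fun i' j => if i' = i then rowSeries μ i' * colSeries μ j else 0)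
      (μ.colLen 0 + i + 1) (by omega), Finset.sum_eq_single i]
    · simp [Finset.mul_sum]
    · intro b _ hb; simp [hb]
    · intro hi; exact absurd (Finset.mem_range.2 (by omega)) hi
  rw [mul_assoc, ← h]
  ext m
  rcases m with - | m
  · simp [rowSeries, rowSum_zero]
  · rw [map_add, coeff_succ_X_mul, map_sum]
    simp only [rowSeries, coeff_mk, rowSum_succ, coeff_one]
    rw [if_neg (Nat.succ_ne_zero m), zero_add]
    refine Finset.sum_congr rfl fun c _ => ?_
    split_ifs <;> simp

theorem sum_cells_col (μ : YoungDiagram) (f : ℕ → ℕ → ℚ⟦X⟧) (j : ℕ) :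
    ∑ c : μ.cells, (if c.1.2 = j then f c.1.1 c.1.2 else 0) =
      ∑ i ∈ Finset.range (μ.colLen j), f i j := by
  rw [Finset.sum_coe_sort μ.cells fun c => if c.2 = j then f c.1 c.2 else 0, ← Finset.sum_filter]
  change ∑ c ∈ μ.col j, _ = _
  rw [YoungDiagram.col_eq_prod, Finset.sum_product]
  simp

theorem colSeries_eq (μ : YoungDiagram) (j : ℕ) :
    colSeries μ j = 1 - X * colSeries μ j *
      ∑ i ∈ Finset.range (μ.colLen j), rowSeries μ i := by
  have h : ∑ c : μ.cells, (if c.1.2 = j then mk fun m => boxSum μ m c else 0) =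
      colSeries μ j * ∑ i ∈ Finset.range (μ.colLen j), rowSeries μ i := by
    simp_rw [mk_boxSum]
    rw [sum_cells_col μ (fun i j => rowSeries μ i * colSeries μ j), ← Finset.sum_mul, mul_comm]
  rw [mul_assoc, ← h]
  ext m
  rcases m with - | m
  · simp [colSeries]
  · rw [map_sub, coeff_succ_X_mul, map_sum]
    simp only [colSeries, coeff_mk, colSum_succ, coeff_one]
    rw [if_neg (Nat.succ_ne_zero m), if_neg (Nat.succ_ne_zero m), zero_sub]
    congr 1
    refine Finset.sum_congr rfl fun c _ => ?_
    split_ifs <;> simp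

/-- The generating series of the free cumulants. -/
noncomputable def cumulantSeries (μ : YoungDiagram) : ℚ⟦X⟧ :=
  1 + X * (X * ∑ c : μ.cells, mk fun m => boxSum μ m c)

theorem coeff_cumulantSeries (μ : YoungDiagram) (m : ℕ) :
    coeff (m + 2) (cumulantSeries μ) = freeCumulant μ (m + 2) := by
  rw [cumulantSeries, map_add, coeff_succ_X_mul, coeff_succ_X_mul,
    freeCumulant_eq_planarSum, planarSum_one, map_sum]
  simp [coeff_one]

theorem constantCoeff_cumulantSeries (μ : YoungDiagram) :
    constantCoeff (cumulantSeries μ) = 1 := by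
  simp [cumulantSeries]

/-- `cumulantSeries` in terms of the row series. -/
theorem cumulantSeries_eq (μ : YoungDiagram) :
    cumulantSeries μ = 1 + X * ∑ i ∈ Finset.range (μ.colLen 0), rowSeries μ i -
      (μ.colLen 0 : ℚ⟦X⟧) * X := by
  have h : X * ∑ c : μ.cells, (mk fun m => boxSum μ m c) =
      ∑ i ∈ Finset.range (μ.colLen 0), (rowSeries μ i - 1) := by
    simp_rw [mk_boxSum]
    rw [sum_cells_rows μ (fun i j => rowSeries μ i * colSeries μ j) _ le_rfl, Finset.mul_sum]
    refine Finset.sum_congr rfl fun i _ => ?_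
    conv_rhs => rw [rowSeries_eq]
    rw [← Finset.mul_sum]
    ring
  rw [cumulantSeries, h, Finset.sum_sub_distrib]
  simp
  ring

end GeneratingSeries

section BoundaryEquation

open PowerSeries

/-- Series attached to the vertical boundary line with abscissa `x`. -/
noncomputable def colLine (μ : YoungDiagram) (x : ℕ) : ℚ⟦X⟧ :=
  1 - X * ∑ j ∈ Finset.range x, colSeries μ j

/-- Series attached to the horizontal boundary line with ordinate `y`. -/
noncomputable def rowLine (μ : YoungDiagram) (y : ℕ) : ℚ⟦X⟧ :=
  1 + X * ∑ i ∈ Finset.range y, rowSeries μ i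

theorem colLine_mul_rowLine_succ (μ : YoungDiagram) (y : ℕ) :
    colLine μ (μ.rowLen y) * rowLine μ (y + 1) =
      colLine μ (μ.rowLen y) * rowLine μ y + X := by
  have h := rowSeries_eq μ y
  rw [rowLine, Finset.sum_range_succ, rowLine, colLine]
  linear_combination X * h

theorem colLine_succ_mul_rowLine (μ : YoungDiagram) (x : ℕ) :
    colLine μ (x + 1) * rowLine μ (μ.colLen x) =
      colLine μ x * rowLine μ (μ.colLen x) - X := by
  have h := colSeries_eq μ x
  rw [colLine, Finset.sum_range_succ, rowLine, colLine]
  linear_combination -X * h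

theorem colLine_mul_rowLine_of_step (μ : YoungDiagram) (y d : ℕ)
    (h : μ.rowLen (y + 1) + d ≤ μ.rowLen y) :
    colLine μ (μ.rowLen (y + 1) + d) * rowLine μ (y + 1) + (d : ℚ⟦X⟧) * X =
      colLine μ (μ.rowLen (y + 1)) * rowLine μ (y + 1) := by
  induction d with
  | zero => simp
  | succ d ih =>
    have hc : μ.colLen (μ.rowLen (y + 1) + d) = y + 1 := by
      have h1 := YoungDiagram.mem_iff_lt_colLen.1
        (YoungDiagram.mem_iff_lt_rowLen.2 (show μ.rowLen (y + 1) + d < μ.rowLen y by omega))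
      have h2 := mt YoungDiagram.mem_iff_lt_colLen.2
        (mt YoungDiagram.mem_iff_lt_rowLen.1
          (show ¬ μ.rowLen (y + 1) + d < μ.rowLen (y + 1) by omega))
      omega
    have h1 := colLine_succ_mul_rowLine μ (μ.rowLen (y + 1) + d)
    rw [hc] at h1
    rw [← ih (by omega), ← add_assoc, h1]
    push_cast
    ring

theorem rowLen_colLen_zero (μ : YoungDiagram) : μ.rowLen (μ.colLen 0) = 0 := by
  by_contra h
  exact lt_irrefl _ (YoungDiagram.mem_iff_lt_colLen.1
    (YoungDiagram.mem_iff_lt_rowLen.2 (Nat.pos_of_ne_zero h)))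

theorem colLine_mul_rowLine_add (μ : YoungDiagram) (y : ℕ) :
    colLine μ (μ.rowLen y) * rowLine μ y + ((μ.rowLen y : ℚ⟦X⟧) - (y : ℚ⟦X⟧)) * X =
      cumulantSeries μ := by
  have step : ∀ y, colLine μ (μ.rowLen (y + 1)) * rowLine μ (y + 1) +
      ((μ.rowLen (y + 1) : ℚ⟦X⟧) - ((y + 1 : ℕ) : ℚ⟦X⟧)) * X =
      colLine μ (μ.rowLen y) * rowLine μ y +
        ((μ.rowLen y : ℚ⟦X⟧) - (y : ℚ⟦X⟧)) * X := by
    intro y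
    obtain ⟨d, hd⟩ := Nat.exists_eq_add_of_le (μ.rowLen_anti y (y + 1) (Nat.le_succ y))
    have h1 := colLine_mul_rowLine_of_step μ y d hd.ge
    have h2 := colLine_mul_rowLine_succ μ y
    rw [← hd] at h1
    have h3 : (μ.rowLen y : ℚ⟦X⟧) = (μ.rowLen (y + 1) : ℚ⟦X⟧) + (d : ℚ⟦X⟧) := by
      rw [hd]
      push_cast
      ring
    push_cast
    linear_combination h2 - h1 - X * h3
  have const : ∀ y, colLine μ (μ.rowLen y) * rowLine μ y +
      ((μ.rowLen y : ℚ⟦X⟧) - (y : ℚ⟦X⟧)) * X =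
      colLine μ (μ.rowLen 0) * rowLine μ 0 +
        ((μ.rowLen 0 : ℚ⟦X⟧) - ((0 : ℕ) : ℚ⟦X⟧)) * X := by
    intro y
    induction y with
    | zero => rfl
    | succ y ih => rw [step, ih]
  rw [const, ← const (μ.colLen 0), rowLen_colLen_zero, cumulantSeries_eq, rowLine, colLine]
  simp
  ring

/-- Equation of the boundary of `μ` in terms of the generating series of free cumulants. -/
theorem cumulantSeries_mul_prod (μ : YoungDiagram) :
    (cumulantSeries μ + (μ.colLen 0 : ℚ⟦X⟧) * X) *
      ∏ y ∈ Finset.range (μ.colLen 0),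
        (cumulantSeries μ - ((μ.rowLen y : ℚ⟦X⟧) - (y : ℚ⟦X⟧)) * X) =
      ∏ y ∈ Finset.range (μ.colLen 0),
        (cumulantSeries μ - ((μ.rowLen y : ℚ⟦X⟧) - (y : ℚ⟦X⟧) - 1) * X) := by
  have key : ∀ ℓ, rowLine μ ℓ * ∏ y ∈ Finset.range ℓ,
        (cumulantSeries μ - ((μ.rowLen y : ℚ⟦X⟧) - (y : ℚ⟦X⟧)) * X) =
      ∏ y ∈ Finset.range ℓ,
        (cumulantSeries μ - ((μ.rowLen y : ℚ⟦X⟧) - (y : ℚ⟦X⟧) - 1) * X) := by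
    intro ℓ
    induction ℓ with
    | zero => simp [rowLine]
    | succ y ih =>
      rw [Finset.prod_range_succ, Finset.prod_range_succ, ← ih]
      have h1 := colLine_mul_rowLine_add μ y
      have h2 := colLine_mul_rowLine_succ μ y
      have h3 : cumulantSeries μ - ((μ.rowLen y : ℚ⟦X⟧) - (y : ℚ⟦X⟧)) * X =
          colLine μ (μ.rowLen y) * rowLine μ y := by rw [← h1]; ring
      have h4 : cumulantSeries μ - ((μ.rowLen y : ℚ⟦X⟧) - (y : ℚ⟦X⟧) - 1) * X =
          colLine μ (μ.rowLen y) * rowLine μ (y + 1) := by rw [h2, ← h1]; ring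
      rw [h3, h4]
      ring
  rw [← key, cumulantSeries_eq, rowLine]
  ring

end BoundaryEquation

section Lagrange

open PowerSeries

theorem exists_eq_sum_add_X_pow_mul (f : ℚ⟦X⟧) (n : ℕ) :
    ∃ g, f = ∑ k ∈ Finset.range n, coeff k f • (X : ℚ⟦X⟧) ^ k + X ^ n * g := by
  obtain ⟨g, hg⟩ := X_pow_dvd_iff.2 (show ∀ d < n,
      coeff d (f - ∑ k ∈ Finset.range n, coeff k f • (X : ℚ⟦X⟧) ^ k) = 0 by
    intro d hd
    simp [coeff_X_pow, hd])
  exact ⟨g, by rw [← hg]; ring⟩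

theorem coeff_pow_mul_sub_X_mul_derivative (K : ℚ⟦X⟧) (d : ℕ) :
    coeff (d + 1) (K ^ d * (K - X * d⁄dX ℚ K)) = 0 := by
  have h : ((d + 1 : ℕ) : ℚ⟦X⟧) * (K ^ d * (K - X * d⁄dX ℚ K)) =
      ((d + 1 : ℕ) : ℚ⟦X⟧) * K ^ (d + 1) - X * d⁄dX ℚ (K ^ (d + 1)) := by
    rw [derivative_pow, Nat.add_sub_cancel]
    ring
  have h2 := congrArg (coeff (d + 1)) h
  rw [map_sub, coeff_succ_X_mul, coeff_derivative, ← nsmul_eq_mul, ← nsmul_eq_mul, map_nsmul,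
    map_nsmul, nsmul_eq_mul, nsmul_eq_mul] at h2
  push_cast at h2
  rw [mul_comm (coeff (d + 1) (K ^ (d + 1))), sub_self] at h2
  exact (mul_eq_zero.1 h2).resolve_left (by positivity)

/-- A form of the Lagrange inversion formula. -/
theorem coeff_eq_of_comp_mul_pow_eq_one {φ : ℚ⟦X⟧ →ₐ[ℚ] ℚ⟦X⟧} {K L f : ℚ⟦X⟧} (hKL : K * L = 1)
    (hK : constantCoeff K = 1) (hφ : φ X = X * L) (m : ℕ) (hf : φ f * K ^ m = 1) :
    coeff (m + 1) f = -(m : ℚ) * coeff (m + 1) K := by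
  set J := K - X * d⁄dX ℚ K with hJ
  obtain ⟨g, hg⟩ := exists_eq_sum_add_X_pow_mul f (m + 2)
  have hL : constantCoeff L = 1 := by
    have := congrArg constantCoeff hKL
    simpa [hK] using this
  have h1 : J = ∑ k ∈ Finset.range (m + 2), coeff k f • (X ^ k * (L ^ k * K ^ m * J)) +
      X ^ (m + 2) * (L ^ (m + 2) * φ g * K ^ m * J) := by
    have h2 : φ f = ∑ k ∈ Finset.range (m + 2), coeff k f • (X ^ k * L ^ k) +
        X ^ (m + 2) * (L ^ (m + 2) * φ g) := by
      conv_lhs => rw [hg]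
      simp [hφ, mul_pow, mul_assoc]
    calc J = φ f * K ^ m * J := by rw [hf, one_mul]
      _ = _ := by
        rw [h2, add_mul, add_mul, Finset.sum_mul, Finset.sum_mul]
        congr 1
        · refine Finset.sum_congr rfl fun k _ => ?_
          rw [smul_mul_assoc, smul_mul_assoc]
          congr 1
          ring
        · ring
  have h3 := congrArg (coeff (m + 1)) h1
  rw [map_add, coeff_X_pow_mul', if_neg (by omega), add_zero, map_sum,
    Finset.sum_range_succ, Finset.sum_eq_zero, zero_add] at h3
  · rw [map_smul, coeff_X_pow_mul', if_pos le_rfl, Nat.sub_self] at h3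
    have h4 : coeff 0 (L ^ (m + 1) * K ^ m * J) = 1 := by simp [hJ, hL, hK]
    rw [h4, smul_eq_mul, mul_one, hJ, map_sub, coeff_succ_X_mul, coeff_derivative] at h3
    rw [← h3]
    ring
  · intro k hk
    have hk' := Finset.mem_range.1 hk
    rw [map_smul, coeff_X_pow_mul', if_pos (by omega)]
    obtain ⟨d, rfl⟩ := Nat.exists_eq_add_of_le (Nat.lt_succ_iff.1 hk')
    rw [show L ^ k * K ^ (k + d) = K ^ d by
      rw [pow_add, ← mul_assoc, ← mul_pow, mul_comm L, hKL, one_pow, one_mul],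
      show k + d + 1 - k = d + 1 by omega, coeff_pow_mul_sub_X_mul_derivative, smul_zero]

/-- The series `-log (1 - cX)`. -/
noncomputable def negLog (c : ℚ) : ℚ⟦X⟧ := mk fun k => c ^ k / k

theorem derivative_negLog_mul (c : ℚ) : d⁄dX ℚ (negLog c) * (1 - C c * X) = C c := by
  ext n
  rw [mul_sub, mul_one, mul_comm (C c), ← mul_assoc, map_sub, coeff_mul_C, coeff_derivative]
  rcases n with - | n
  · simp [negLog]
  · rw [coeff_succ_mul_X, coeff_derivative, negLog, coeff_mk, coeff_mk, coeff_C,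
      if_neg n.succ_ne_zero]
    have h1 : ((n : ℚ) + 1) ≠ 0 := by positivity
    have h2 : ((n : ℚ) + 1 + 1) ≠ 0 := by positivity
    push_cast
    field_simp
    ring

theorem derivative_one_sub_C_mul_X (c : ℚ) :
    d⁄dX ℚ (1 - C c * X) = -d⁄dX ℚ (negLog c) * (1 - C c * X) := by
  rw [neg_mul, derivative_negLog_mul]
  simp

theorem derivative_prod_one_sub {ι : Type*} (s : Finset ι) (c : ι → ℚ) :
    d⁄dX ℚ (∏ i ∈ s, (1 - C (c i) * X)) =
      -(∑ i ∈ s, d⁄dX ℚ (negLog (c i))) * ∏ i ∈ s, (1 - C (c i) * X) := by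
  classical
  induction s using Finset.induction_on with
  | empty => simp
  | insert a s ha ih =>
    rw [Finset.prod_insert ha, Finset.sum_insert ha, Derivation.leibniz, ih,
      derivative_one_sub_C_mul_X, smul_eq_mul, smul_eq_mul]
    ring

theorem coeff_subst_exp {T : ℚ⟦X⟧} (hT : constantCoeff T = 0) (n : ℕ) :
    coeff n ((exp ℚ).subst T) =
      ∑ l ∈ Finset.range (n + 1), 1 / (l.factorial : ℚ) * coeff n (T ^ l) := by
  rw [coeff_subst' (HasSubst.of_constantCoeff_zero' hT),
    finsum_eq_sum_of_support_subset (s := Finset.range (n + 1))]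
  · simp [coeff_exp]
  · intro l hl
    rw [Finset.mem_coe, Finset.mem_range]
    by_contra h
    refine hl ?_
    obtain ⟨U, rfl⟩ := X_dvd_iff.2 hT
    change _ • coeff n ((X * U) ^ l) = 0
    rw [mul_pow, coeff_X_pow_mul', if_neg (by omega), smul_zero]

theorem subst_exp_mul_pow (S Ψ : ℚ⟦X⟧) (hS : constantCoeff S = 0) (hΨ : constantCoeff Ψ = 1)
    (h : d⁄dX ℚ Ψ = d⁄dX ℚ S * Ψ) (m : ℕ) :
    (exp ℚ).subst (-(m : ℚ) • S) * Ψ ^ m = 1 := by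
  have hs : HasSubst (-(m : ℚ) • S) := HasSubst.of_constantCoeff_zero' (by simp [hS])
  refine derivative.ext ?_ ?_
  · rw [Derivation.leibniz, derivative_subst hs, derivative_pow, derivative_exp, h, derivative_one,
      smul_eq_mul, smul_eq_mul, Derivation.map_smul, smul_eq_C_mul (d⁄dX ℚ S)]
    generalize (exp ℚ).subst (-(m : ℚ) • S) = E
    rcases m with - | m
    · simp
    · rw [Nat.add_sub_cancel, pow_succ, map_neg, map_natCast]
      ring
  · rw [map_mul, map_pow, hΨ, one_pow, mul_one, map_one, ← coeff_zero_eq_constantCoeff_apply,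
      coeff_subst_exp (by simp [hS])]
    simp

end Lagrange

section Boundary

open PowerSeries

/-- Generating series of the parameters `Sparam μ k`, in terms of the boundary of `μ`. -/
noncomputable def logSeries (μ : YoungDiagram) : ℚ⟦X⟧ :=
  ∑ y ∈ Finset.range (μ.colLen 0),
    (negLog ((μ.rowLen y : ℚ) - y) - negLog ((μ.rowLen y : ℚ) - y - 1)) + negLog (-(μ.colLen 0 : ℚ))

theorem coeff_logSeries (μ : YoungDiagram) (k : ℕ) (hk : k ≠ 0) :
    coeff k (logSeries μ) = (∑ y ∈ Finset.range (μ.colLen 0),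
      (((μ.rowLen y : ℚ) - y) ^ k - ((μ.rowLen y : ℚ) - y - 1) ^ k
        - (-(y : ℚ)) ^ k + (-(y : ℚ) - 1) ^ k)) / k := by
  have h : (-(μ.colLen 0 : ℚ)) ^ k =
      ∑ y ∈ Finset.range (μ.colLen 0), ((-(y : ℚ) - 1) ^ k - (-(y : ℚ)) ^ k) := by
    have := Finset.sum_range_sub (fun y : ℕ => (-(y : ℚ)) ^ k) (μ.colLen 0)
    simp only [Nat.cast_add, Nat.cast_one, Nat.cast_zero, neg_zero, zero_pow hk, sub_zero,
      neg_add'] at this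
    exact this.symm
  rw [logSeries, map_add, map_sum]
  simp only [map_sub, negLog, coeff_mk]
  rw [h, Finset.sum_div, Finset.sum_div, ← Finset.sum_add_distrib]
  refine Finset.sum_congr rfl fun y _ => ?_
  ring

theorem coeff_logSeries_of_lt_two (μ : YoungDiagram) (k : ℕ) (hk : k < 2) :
    coeff k (logSeries μ) = 0 := by
  interval_cases k
  · simp [logSeries, negLog]
  · rw [coeff_logSeries _ _ one_ne_zero, Finset.sum_eq_zero fun y _ => by ring, zero_div]

theorem constantCoeff_logSeries (μ : YoungDiagram) : constantCoeff (logSeries μ) = 0 := by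
  rw [← coeff_zero_eq_constantCoeff_apply, coeff_logSeries_of_lt_two _ _ two_pos]

theorem exists_derivative_eq_mul (μ : YoungDiagram) :
    ∃ Ψ : ℚ⟦X⟧, constantCoeff Ψ = 1 ∧ d⁄dX ℚ Ψ = d⁄dX ℚ (logSeries μ) * Ψ ∧
      (1 - C (-(μ.colLen 0 : ℚ)) * X) *
          (∏ y ∈ Finset.range (μ.colLen 0), (1 - C ((μ.rowLen y : ℚ) - y) * X)) * Ψ =
        ∏ y ∈ Finset.range (μ.colLen 0), (1 - C ((μ.rowLen y : ℚ) - y - 1) * X) := by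
  set N := ∏ y ∈ Finset.range (μ.colLen 0), (1 - C ((μ.rowLen y : ℚ) - y - 1) * X) with hN
  set E := 1 - C (-(μ.colLen 0 : ℚ)) * X with hE
  set D := ∏ y ∈ Finset.range (μ.colLen 0), (1 - C ((μ.rowLen y : ℚ) - y) * X) with hD
  have hN1 : constantCoeff N = 1 := by simp [hN, map_prod]
  have hE1 : constantCoeff E = 1 := by simp [hE]
  have hD1 : constantCoeff D = 1 := by simp [hD, map_prod]
  have h0 : constantCoeff (E * D) ≠ 0 := by simp [hE1, hD1]
  have hDE : E * D ≠ 0 := fun h => h0 (by rw [h, map_zero])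
  have hmul : E * D * ((E * D)⁻¹ * N) = N := by
    rw [← mul_assoc, PowerSeries.mul_inv_cancel _ h0, one_mul]
  refine ⟨(E * D)⁻¹ * N, ?_, ?_, hmul⟩
  · simp [hE1, hD1, hN1]
  · generalize (E * D)⁻¹ * N = Ψ at hmul
    have h1 : d⁄dX ℚ E = -d⁄dX ℚ (negLog (-(μ.colLen 0 : ℚ))) * E := derivative_one_sub_C_mul_X _
    have h2 : d⁄dX ℚ D = _ * D := derivative_prod_one_sub _ fun y : ℕ => (μ.rowLen y : ℚ) - y
    have h3 : d⁄dX ℚ N = _ * N := derivative_prod_one_sub _ fun y : ℕ => (μ.rowLen y : ℚ) - y - 1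
    have h4 : d⁄dX ℚ (logSeries μ) = ∑ y ∈ Finset.range (μ.colLen 0),
          d⁄dX ℚ (negLog ((μ.rowLen y : ℚ) - y)) - ∑ y ∈ Finset.range (μ.colLen 0),
          d⁄dX ℚ (negLog ((μ.rowLen y : ℚ) - y - 1)) + d⁄dX ℚ (negLog (-(μ.colLen 0 : ℚ))) := by
      rw [logSeries, map_add, map_sum, ← Finset.sum_sub_distrib]
      simp only [map_sub]
    have h5 := congrArg (d⁄dX ℚ) hmul
    rw [Derivation.leibniz, Derivation.leibniz, h1, h2, h3, smul_eq_mul, smul_eq_mul, smul_eq_mul,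
      smul_eq_mul, ← hmul] at h5
    refine mul_left_cancel₀ hDE ?_
    rw [h4]
    linear_combination h5

theorem freeCumulant_eq_sum_coeff (μ : YoungDiagram) (m : ℕ) :
    freeCumulant μ (m + 2) = ∑ l ∈ Finset.Icc 1 (m + 2),
      1 / (l.factorial : ℚ) * (-((m : ℚ) + 1)) ^ (l - 1) * coeff (m + 2) (logSeries μ ^ l) := by
  obtain ⟨Ψ, hΨ, hd, hmul⟩ := exists_derivative_eq_mul μ
  have hK := constantCoeff_cumulantSeries μ
  have hprod := cumulantSeries_mul_prod μ
  rw [← coeff_cumulantSeries]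
  set K := cumulantSeries μ
  have hKL : K * K⁻¹ = 1 := PowerSeries.mul_inv_cancel _ (by simp [hK])
  generalize K⁻¹ = L at hKL
  have hs : HasSubst (X * L) := HasSubst.of_constantCoeff_zero' (by simp)
  let φ : ℚ⟦X⟧ →ₐ[ℚ] ℚ⟦X⟧ := substAlgHom hs
  have hφ : φ X = X * L := substAlgHom_X hs
  have hφC : ∀ c : ℚ, φ (C c) = C c := fun c => φ.commutes c
  have hfac : ∀ c : ℚ, φ (1 - C c * X) * K = K - C c * X := fun c => by
    rw [map_sub, map_one, map_mul, hφ, hφC]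
    linear_combination -C c * X * hKL
  have hφΨ : φ Ψ = K := by
    have h1 := congrArg φ hmul
    rw [map_mul, map_mul, map_prod, map_prod] at h1
    have h2 : ∀ c : ℕ → ℚ, (∏ y ∈ Finset.range (μ.colLen 0), φ (1 - C (c y) * X)) *
        K ^ μ.colLen 0 = ∏ y ∈ Finset.range (μ.colLen 0), (K - C (c y) * X) := fun c => by
      rw [← Finset.prod_congr rfl fun y _ => hfac (c y), Finset.prod_mul_distrib]
      simp
    have h3 := h2 fun y => (μ.rowLen y : ℚ) - y
    have h4 := h2 fun y => (μ.rowLen y : ℚ) - y - 1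
    have h5 := hfac (-(μ.colLen 0 : ℚ))
    have h6 : (K - C (-(μ.colLen 0 : ℚ)) * X) *
        ∏ y ∈ Finset.range (μ.colLen 0), (K - C ((μ.rowLen y : ℚ) - y) * X) =
        ∏ y ∈ Finset.range (μ.colLen 0), (K - C ((μ.rowLen y : ℚ) - y - 1) * X) := by
      simpa using hprod
    have hne : ∏ y ∈ Finset.range (μ.colLen 0), (K - C ((μ.rowLen y : ℚ) - y - 1) * X) ≠ 0 := by
      intro h
      simpa [map_prod, hK] using congrArg constantCoeff h
    refine mul_left_cancel₀ hne ?_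
    rw [← h4, ← h1] at h6 ⊢
    rw [← h5, ← h3] at h6
    linear_combination (-φ Ψ) * h6
  have hf := subst_exp_mul_pow _ Ψ (constantCoeff_logSeries μ) hΨ hd (m + 1)
  have hf' := congrArg φ hf
  rw [map_mul, map_pow, hφΨ, map_one] at hf'
  have h := coeff_eq_of_comp_mul_pow_eq_one hKL hK hφ (m + 1) hf'
  rw [coeff_subst_exp (by simp [constantCoeff_logSeries]), Finset.sum_range_succ', pow_zero,
    coeff_one, if_neg (Nat.succ_ne_zero _), mul_zero, add_zero] at h
  have hm : (-((m + 1 : ℕ) : ℚ)) ≠ 0 := neg_ne_zero.2 (Nat.cast_ne_zero.2 m.succ_ne_zero)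
  refine mul_left_cancel₀ hm ?_
  rw [← h, Finset.mul_sum, ← Finset.Ico_add_one_right_eq_Icc, Finset.sum_Ico_eq_sum_range]
  refine Finset.sum_congr rfl fun l _ => ?_
  rw [smul_pow, map_smul, add_comm 1 l, Nat.add_sub_cancel, pow_succ, smul_eq_mul]
  push_cast
  ring

theorem coeff_logSeries_pow (μ : YoungDiagram) (n l : ℕ) :
    coeff n (logSeries μ ^ l) =
      ∑ kk ∈ (Fintype.piFinset fun _ : Fin l => Finset.Icc 2 n).filter
        (fun kk => ∑ j, kk j = n), ∏ j, coeff (kk j) (logSeries μ) := by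
  have h := coeff_prod (fun _ : Fin l => logSeries μ) n Finset.univ
  rw [Finset.prod_const, Finset.card_univ, Fintype.card_fin] at h
  rw [h]
  symm
  refine Finset.sum_of_injOn Finsupp.equivFunOnFinite.symm
    Finsupp.equivFunOnFinite.symm.injective.injOn ?_ ?_ ?_
  · intro kk hkk
    simp only [Finset.coe_filter, Set.mem_ofPred_eq] at hkk
    simp [hkk.2]
  · intro kk hkk hnot
    rw [Finset.mem_finsuppAntidiag] at hkk
    by_contra hne
    refine hnot ⟨kk, ?_, by ext; simp⟩
    rw [Finset.coe_filter, Set.mem_ofPred_eq, Fintype.mem_piFinset]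
    refine ⟨fun j => ?_, hkk.1⟩
    rw [Finset.mem_Icc]
    constructor
    · by_contra hj
      exact hne (Finset.prod_eq_zero (Finset.mem_univ j)
        (coeff_logSeries_of_lt_two μ _ (by omega)))
    · rw [← hkk.1]
      exact Finset.single_le_sum (f := kk) (fun _ _ => Nat.zero_le _) (Finset.mem_univ j)
  · intro kk _
    simp

end Boundary

section Integral

open MeasureTheory

theorem integrableOn_row (k r y : ℕ) : IntegrableOn (fun p : ℝ × ℝ => (p.1 - p.2) ^ k)
    (Set.Icc (0 : ℝ) r ×ˢ Set.Ico (y : ℝ) (y + 1)) := by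
  refine IntegrableOn.mono_set (t := Set.Icc (0 : ℝ) r ×ˢ Set.Icc (y : ℝ) (y + 1)) ?_
    (Set.prod_mono_right Set.Ico_subset_Icc_self)
  exact ContinuousOn.integrableOn_compact (isCompact_Icc.prod isCompact_Icc) (by fun_prop)

theorem setIntegral_row (k r y : ℕ) :
    ∫ p in Set.Icc (0 : ℝ) r ×ˢ Set.Ico (y : ℝ) (y + 1), (p.1 - p.2) ^ k =
      (((r : ℝ) - y) ^ (k + 2) - ((r : ℝ) - y - 1) ^ (k + 2)
        - (-(y : ℝ)) ^ (k + 2) + (-(y : ℝ) - 1) ^ (k + 2)) / ((k + 1) * (k + 2)) := by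
  have hinner : ∀ x : ℝ, ∫ t in Set.Ico (y : ℝ) (y + 1), (x - t) ^ k =
      ((x - y) ^ (k + 1) - (x - y - 1) ^ (k + 1)) / (k + 1) := fun x => by
    rw [integral_Ico_eq_integral_Ioc, ← intervalIntegral.integral_of_le (by linarith),
      intervalIntegral.integral_comp_sub_left (fun u => u ^ k) x, integral_pow, sub_sub]
  have hpow : ∀ c : ℝ, ∫ x in (0 : ℝ)..r, (x - c) ^ (k + 1) =
      (((r : ℝ) - c) ^ (k + 2) - (-c) ^ (k + 2)) / (k + 2) := fun c => by
    rw [intervalIntegral.integral_comp_sub_right (fun u => u ^ (k + 1)) c, integral_pow, zero_sub]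
    push_cast
    ring
  rw [Measure.volume_eq_prod, setIntegral_prod _ (integrableOn_row k r y)]
  simp only [hinner]
  rw [integral_Icc_eq_integral_Ioc, ← intervalIntegral.integral_of_le (Nat.cast_nonneg r),
    intervalIntegral.integral_div, intervalIntegral.integral_sub, hpow]
  · simp only [sub_sub]
    rw [hpow]
    have h1 : ((k : ℝ) + 1) ≠ 0 := by positivity
    have h2 : ((k : ℝ) + 2) ≠ 0 := by positivity
    field_simp
    ring
  all_goals exact (by fun_prop : Continuous _).intervalIntegrable _ _

theorem frenchRegion_ae_eq (μ : YoungDiagram) :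
    frenchRegion μ =ᵐ[volume] ⋃ y ∈ Finset.range (μ.colLen 0),
      Set.Icc (0 : ℝ) (μ.rowLen y) ×ˢ Set.Ico (y : ℝ) (y + 1) := by
  have hnull : volume (({0} : Set ℝ) ×ˢ (Set.univ : Set ℝ)) = 0 := by
    rw [Measure.volume_eq_prod, Measure.prod_prod]
    simp
  filter_upwards [measure_eq_zero_iff_ae_notMem.1 hnull] with p hp
  refine propext ?_
  change p ∈ frenchRegion μ ↔ p ∈ ⋃ y ∈ Finset.range (μ.colLen 0), _
  simp only [Set.mem_iUnion, Finset.mem_range, Set.mem_prod, Set.mem_Icc, Set.mem_Ico, exists_prop]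
  constructor
  · rintro ⟨h1, h2, h3⟩
    have hfl : (⌊p.2⌋.toNat : ℝ) = ⌊p.2⌋ := by
      exact_mod_cast Int.toNat_of_nonneg (Int.floor_nonneg.2 h2)
    refine ⟨⌊p.2⌋.toNat, ?_, ⟨h1, h3⟩, ?_, ?_⟩
    · have h4 : p.1 ≠ 0 := fun h => hp ⟨h, trivial⟩
      have h5 : (0 : ℝ) < μ.rowLen ⌊p.2⌋.toNat := lt_of_lt_of_le (lt_of_le_of_ne h1 h4.symm) h3
      exact YoungDiagram.mem_iff_lt_colLen.1 (YoungDiagram.mem_iff_lt_rowLen.2 (Nat.cast_pos.1 h5))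
    · rw [hfl]; exact Int.floor_le _
    · rw [hfl]; exact Int.lt_floor_add_one _
  · rintro ⟨y, -, ⟨h1, h2⟩, h3, h4⟩
    have hfl : ⌊p.2⌋ = (y : ℤ) := Int.floor_eq_iff.2 ⟨by exact_mod_cast h3, by exact_mod_cast h4⟩
    refine ⟨h1, le_trans (Nat.cast_nonneg y) h3, ?_⟩
    rw [hfl]
    simpa using h2

theorem Sparam_eq (μ : YoungDiagram) (k : ℕ) :
    Sparam μ (k + 2) = ((PowerSeries.coeff (k + 2) (logSeries μ) : ℚ) : ℝ) := by
  rw [Sparam, setIntegral_congr_set (frenchRegion_ae_eq μ), integral_biUnion_finset,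
    coeff_logSeries _ _ (Nat.succ_ne_zero _), Nat.add_sub_cancel]
  · simp only [setIntegral_row]
    rw [← Finset.sum_div]
    have h1 : ((k : ℝ) + 1) ≠ 0 := by positivity
    have h2 : ((k : ℝ) + 2) ≠ 0 := by positivity
    push_cast
    field_simp
    ring
  · exact fun y _ => measurableSet_Icc.prod measurableSet_Ico
  · intro y _ z _ hyz
    refine Set.disjoint_left.2 fun p hp hq => hyz ?_
    have h1 := hp.2
    have h2 := hq.2
    rw [Set.mem_Ico] at h1 h2
    have h3 : y < z + 1 := by exact_mod_cast h1.1.trans_lt h2.2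
    have h4 : z < y + 1 := by exact_mod_cast h2.1.trans_lt h1.2
    omega
  · exact fun y _ => integrableOn_row k _ y

end Integral

/-- For every `n ≥ 2` and every Young diagram `μ`, the `n`-th free cumulant is
expressed in terms of the parameters `S_i^μ` by
`R_n = ∑_{l ≥ 1} (1/l!) (−n+1)^{l−1} ∑_{k_1,…,k_l ≥ 2, k_1+⋯+k_l = n} S_{k_1} ⋯ S_{k_l}`
(only the terms `1 ≤ l ≤ n` can contribute, and `k_j ≤ n` automatically). -/
theorem freeCumulant_eq_Sparam_sum (n : ℕ) (hn : 2 ≤ n) (μ : YoungDiagram) :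
    (freeCumulant μ n : ℝ) =
      ∑ l ∈ Finset.Icc 1 n, (1 / (Nat.factorial l : ℝ)) * (-(n : ℝ) + 1) ^ (l - 1) *
        ∑ kk ∈ (Fintype.piFinset fun _ : Fin l => Finset.Icc 2 n).filter
            (fun kk => ∑ j, kk j = n),
          ∏ j, Sparam μ (kk j) := by
  obtain ⟨m, rfl⟩ := Nat.exists_eq_add_of_le' hn
  have hS : ∀ k, 2 ≤ k → Sparam μ k = ((PowerSeries.coeff k (logSeries μ) : ℚ) : ℝ) := by
    intro k hk
    obtain ⟨i, rfl⟩ := Nat.exists_eq_add_of_le' hk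
    exact Sparam_eq μ i
  rw [freeCumulant_eq_sum_coeff, Rat.cast_sum]
  refine Finset.sum_congr rfl fun l _ => ?_
  rw [coeff_logSeries_pow, Rat.cast_mul, Rat.cast_sum]
  congr 1
  · push_cast
    ring
  · refine Finset.sum_congr rfl fun kk hkk => ?_
    rw [Rat.cast_prod]
    refine Finset.prod_congr rfl fun j _ => (hS _ ?_).symm
    exact (Finset.mem_Icc.1 (Fintype.mem_piFinset.1 (Finset.mem_filter.1 hkk).1 j)).1

end AsympRep
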